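/- arXiv:2110.06626 — 2 statements merged into one kernel-verified Lean document; each statement's English description precedes it below -/
import Mathlib

section
/- Let k be a field and let Λ and Γ be finite dimensional k-algebras that are singularly equivalent of Morita type with level. If Λ is eventually periodic (i.e. eventually periodic as a Λ^e-module), then Γ is eventually periodic; moreover, the period of any nonzero periodic syzygy Ω_{Λ^e}^n(Λ) equals the period of any nonzero periodic syzygy Ω_{Γ^e}^m(Γ). -/
open TensorProduct MulOpposite

section BimodInfra

variable (k : Type) [Field k]

/-- The `k`-algebra endomorphism ring homomorphism sending a `k`-linear endomorphism `f` of `Y`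
to `X ⊗ f`. -/
noncomputable def lTensorAlgHom (X Y : Type) [AddCommGroup X] [Module k X] [AddCommGroup Y] [Module k Y] :
    Module.End k Y →ₐ[k] Module.End k (X ⊗[k] Y) where
  toFun f := LinearMap.lTensor X f
  map_one' := LinearMap.lTensor_id X Y
  map_mul' f g := LinearMap.lTensor_comp X f g
  map_zero' := LinearMap.lTensor_zero X
  map_add' f g := LinearMap.lTensor_add X f g
  commutes' c := by
    ext y
    simp [Module.algebraMap_end_apply, TensorProduct.smul_tmul', TensorProduct.tmul_smul]

/-- Same for `f ⊗ Y`. -/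
noncomputable def rTensorAlgHom (X Y : Type) [AddCommGroup X] [Module k X] [AddCommGroup Y] [Module k Y] :
    Module.End k X →ₐ[k] Module.End k (X ⊗[k] Y) where
  toFun f := LinearMap.rTensor Y f
  map_one' := LinearMap.rTensor_id Y X
  map_mul' f g := LinearMap.rTensor_comp Y f g
  map_zero' := LinearMap.rTensor_zero Y
  map_add' f g := LinearMap.rTensor_add Y f g
  commutes' c := by
    ext x
    simp [Module.algebraMap_end_apply, TensorProduct.smul_tmul', TensorProduct.tmul_smul]

variable (A B C : Type) [Ring A] [Ring B] [Ring C] [Algebra k A] [Algebra k B] [Algebra k C]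
variable (X : Type) [AddCommGroup X] [Module k X] [Module (A ⊗[k] Bᵐᵒᵖ) X]
  [IsScalarTower k (A ⊗[k] Bᵐᵒᵖ) X]
variable (Y : Type) [AddCommGroup Y] [Module k Y] [Module (B ⊗[k] Cᵐᵒᵖ) Y]
  [IsScalarTower k (B ⊗[k] Cᵐᵒᵖ) Y]

/-- The action of `A ⊗ Cᵐᵒᵖ` on `X ⊗[k] Y`: `A` acts through the left tensor factor of `X`,
`Cᵐᵒᵖ` acts through the right tensor factor of `Y`. -/
noncomputable def outerAction : (A ⊗[k] Cᵐᵒᵖ) →ₐ[k] Module.End k (X ⊗[k] Y) :=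
  Algebra.TensorProduct.lift
    ((rTensorAlgHom k X Y).comp ((Algebra.lsmul k k X).comp
      (Algebra.TensorProduct.includeLeft : A →ₐ[k] A ⊗[k] Bᵐᵒᵖ)))
    ((lTensorAlgHom k X Y).comp ((Algebra.lsmul k k Y).comp
      (Algebra.TensorProduct.includeRight : Cᵐᵒᵖ →ₐ[k] B ⊗[k] Cᵐᵒᵖ)))
    (fun a c => by
      show Commute (LinearMap.rTensor Y _) (LinearMap.lTensor X _)
      unfold Commute SemiconjBy
      ext x y
      simp [LinearMap.rTensor, LinearMap.lTensor, TensorProduct.map_tmul])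

/-- The `(A ⊗ Cᵐᵒᵖ)`-module structure on `X ⊗[k] Y`. -/
noncomputable def outerModule : Module (A ⊗[k] Cᵐᵒᵖ) (X ⊗[k] Y) :=
  Module.compHom _ (outerAction k A B C X Y).toRingHom

/-- The submodule of `X ⊗[k] Y` generated by the `B`-balancing relations
`(x·b) ⊗ y - x ⊗ (b·y)`. -/
noncomputable def balancedSub : @Submodule (A ⊗[k] Cᵐᵒᵖ) (X ⊗[k] Y) _ _
    (outerModule k A B C X Y) :=
  letI := outerModule k A B C X Y
  Submodule.span (A ⊗[k] Cᵐᵒᵖ)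
    {z | ∃ (x : X) (b : B) (y : Y),
      z = ((((1 : A) ⊗ₜ[k] (op b)) • x) ⊗ₜ[k] y) - (x ⊗ₜ[k] ((b ⊗ₜ[k] (1 : Cᵐᵒᵖ)) • y))}

/-- The balanced tensor product `X ⊗_B Y` of the `(A,B)`-bimodule `X` and the
`(B,C)`-bimodule `Y`, an `(A,C)`-bimodule, i.e. a left `A ⊗[k] Cᵐᵒᵖ`-module. -/
noncomputable def BTensor : Type :=
  letI := outerModule k A B C X Y
  (X ⊗[k] Y) ⧸ balancedSub k A B C X Y

noncomputable instance BTensor.instAddCommGroup : AddCommGroup (BTensor k A B C X Y) :=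
  letI := outerModule k A B C X Y
  inferInstanceAs (AddCommGroup ((X ⊗[k] Y) ⧸ balancedSub k A B C X Y))

noncomputable instance BTensor.instModule : Module (A ⊗[k] Cᵐᵒᵖ) (BTensor k A B C X Y) :=
  letI := outerModule k A B C X Y
  inferInstanceAs (Module (A ⊗[k] Cᵐᵒᵖ) ((X ⊗[k] Y) ⧸ balancedSub k A B C X Y))

noncomputable instance BTensor.instModuleK : Module k (BTensor k A B C X Y) :=
  Module.compHom _ (algebraMap k (A ⊗[k] Cᵐᵒᵖ))

noncomputable instance BTensor.instTower :
    IsScalarTower k (A ⊗[k] Cᵐᵒᵖ) (BTensor k A B C X Y) :=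
  ⟨fun c s z => by
    have h : (c • s) = algebraMap k (A ⊗[k] Cᵐᵒᵖ) c * s := Algebra.smul_def c s
    rw [h, mul_smul]
    rfl⟩

end BimodInfra

section Restrict

variable (k : Type) [Field k] (A B : Type) [Ring A] [Ring B] [Algebra k A] [Algebra k B]
variable (X : Type) [AddCommGroup X] [Module (A ⊗[k] Bᵐᵒᵖ) X]

/-- The left `A`-module structure on an `(A,B)`-bimodule. -/
noncomputable def leftRestrict : Module A X :=
  Module.compHom X (Algebra.TensorProduct.includeLeft : A →ₐ[k] A ⊗[k] Bᵐᵒᵖ).toRingHom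

/-- The right `B`-module (left `Bᵐᵒᵖ`-module) structure on an `(A,B)`-bimodule. -/
noncomputable def rightRestrict : Module Bᵐᵒᵖ X :=
  Module.compHom X (Algebra.TensorProduct.includeRight : Bᵐᵒᵖ →ₐ[k] A ⊗[k] Bᵐᵒᵖ).toRingHom

/-- The canonical `k`-module structure on a module over the `k`-algebra `S`. -/
def modK (S : Type) [Ring S] [Algebra k S] (Z : Type) [AddCommGroup Z] [Module S Z] :
    Module k Z :=
  Module.compHom Z (algebraMap k S)

/-- The compatibility of `modK` with the `S`-action. -/
def towerK (S : Type) [Ring S] [Algebra k S] (Z : Type) [AddCommGroup Z] [Module S Z] :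
    letI := modK k S Z; IsScalarTower k S Z := by
  letI := modK k S Z
  exact ⟨fun c s z => by
    have h : (c • s) = algebraMap k S c * s := Algebra.smul_def c s
    rw [h, mul_smul]
    rfl⟩

end Restrict

section Regular

variable (k : Type) [Field k] (A : Type) [Ring A] [Algebra k A]

/-- The regular `(A,A)`-bimodule structure on `A`: `(a ⊗ bᵒᵖ) • x = a * x * b`. -/
noncomputable def regularBimodule : Module (A ⊗[k] Aᵐᵒᵖ) A :=
  TensorProduct.Algebra.module

end Regular

/-- `p : P → M` is a projective cover: `P` is finitely generated projective, `p` is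
surjective and `ker p` is superfluous in `P`. -/
def IsProjCover (S : Type) [Ring S] {P M : Type} [AddCommGroup P] [Module S P]
    [AddCommGroup M] [Module S M] (p : P →ₗ[S] M) : Prop :=
  Module.Finite S P ∧ Module.Projective S P ∧ Function.Surjective p ∧
    ∀ L : Submodule S P, L ⊔ LinearMap.ker p = ⊤ → L = ⊤

/-- `Z` is a syzygy of `M`: the kernel of a projective cover of `M`. -/
def IsSyzygyOf (S : Type) [Ring S] (Z M : ModuleCat.{0} S) : Prop :=
  ∃ (P : ModuleCat.{0} S) (p : P →ₗ[S] M),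
    IsProjCover S p ∧ Nonempty (Z ≃ₗ[S] LinearMap.ker p)

/-- `Z` is an `n`-th syzygy of `M` (with respect to projective covers). -/
def IsNthSyzygyOf (S : Type) [Ring S] : ℕ → ModuleCat.{0} S → ModuleCat.{0} S → Prop
  | 0, Z, M => Nonempty (Z ≃ₗ[S] M)
  | n + 1, Z, M => ∃ W : ModuleCat.{0} S, IsNthSyzygyOf S n W M ∧ IsSyzygyOf S Z W

/-- `X` is periodic of period `p`: `Ω^p(X) ≅ X` and `p` is the least positive
integer with this property. -/
def IsPeriodicWithPeriod (S : Type) [Ring S] (X : ModuleCat.{0} S) (p : ℕ) : Prop :=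
  0 < p ∧ (∃ Z, IsNthSyzygyOf S p Z X ∧ Nonempty (Z ≃ₗ[S] X)) ∧
    ∀ q : ℕ, 0 < q → (∃ Z, IsNthSyzygyOf S q Z X ∧ Nonempty (Z ≃ₗ[S] X)) → p ≤ q

/-- `A` and `B` are stably isomorphic: `A ⊕ P ≅ B ⊕ Q` for some finitely generated
projective modules `P` and `Q`. -/
def StablyIso (S : Type) [Ring S] (A B : Type) [AddCommGroup A] [Module S A]
    [AddCommGroup B] [Module S B] : Prop :=
  ∃ P Q : ModuleCat.{0} S,
    Module.Finite S P ∧ Module.Projective S P ∧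
    Module.Finite S Q ∧ Module.Projective S Q ∧
    Nonempty ((A × P) ≃ₗ[S] (B × Q))

section SingEq

variable (k : Type) [Field k]
variable (Λ Γ : Type) [Ring Λ] [Ring Γ] [Algebra k Λ] [Algebra k Γ]
variable (M : Type) [AddCommGroup M] [Module k M] [Module (Λ ⊗[k] Γᵐᵒᵖ) M]
  [IsScalarTower k (Λ ⊗[k] Γᵐᵒᵖ) M]
variable (N : Type) [AddCommGroup N] [Module k N] [Module (Γ ⊗[k] Λᵐᵒᵖ) N]
  [IsScalarTower k (Γ ⊗[k] Λᵐᵒᵖ) N]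

/-- The pair of bimodules `(M, N)` defines a singular equivalence of Morita type with
level `l`:  `M`, `N` are finitely generated projective on either side, `M ⊗_Γ N` is stably
isomorphic to `Ω_{Λᵉ}^l(Λ)` and `N ⊗_Λ M` is stably isomorphic to `Ω_{Γᵉ}^l(Γ)`. -/
noncomputable def DefinesSingEqOfLevel (l : ℕ) : Prop :=
  (letI := leftRestrict k Λ Γ M; Module.Finite Λ M ∧ Module.Projective Λ M) ∧
  (letI := rightRestrict k Λ Γ M; Module.Finite Γᵐᵒᵖ M ∧ Module.Projective Γᵐᵒᵖ M) ∧
  (letI := leftRestrict k Γ Λ N; Module.Finite Γ N ∧ Module.Projective Γ N) ∧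
  (letI := rightRestrict k Γ Λ N; Module.Finite Λᵐᵒᵖ N ∧ Module.Projective Λᵐᵒᵖ N) ∧
  (letI := regularBimodule k Λ;
    ∃ Z : ModuleCat.{0} (Λ ⊗[k] Λᵐᵒᵖ),
      IsNthSyzygyOf (Λ ⊗[k] Λᵐᵒᵖ) l Z (ModuleCat.of (Λ ⊗[k] Λᵐᵒᵖ) Λ) ∧
      StablyIso (Λ ⊗[k] Λᵐᵒᵖ) (BTensor k Λ Γ Λ M N) Z) ∧
  (letI := regularBimodule k Γ;
    ∃ Z : ModuleCat.{0} (Γ ⊗[k] Γᵐᵒᵖ),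
      IsNthSyzygyOf (Γ ⊗[k] Γᵐᵒᵖ) l Z (ModuleCat.of (Γ ⊗[k] Γᵐᵒᵖ) Γ) ∧
      StablyIso (Γ ⊗[k] Γᵐᵒᵖ) (BTensor k Γ Λ Γ N M) Z)

end SingEq

/-- A witness that `Λ` and `Γ` are singularly equivalent of Morita type with level. -/
structure SingEqMoritaLevel (k Λ Γ : Type) [Field k] [Ring Λ] [Ring Γ]
    [Algebra k Λ] [Algebra k Γ] : Type 1 where
  M : Type
  N : Type
  [acgM : AddCommGroup M] [modkM : Module k M] [modM : Module (Λ ⊗[k] Γᵐᵒᵖ) M]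
  [towM : IsScalarTower k (Λ ⊗[k] Γᵐᵒᵖ) M]
  [acgN : AddCommGroup N] [modkN : Module k N] [modN : Module (Γ ⊗[k] Λᵐᵒᵖ) N]
  [towN : IsScalarTower k (Γ ⊗[k] Λᵐᵒᵖ) N]
  l : ℕ
  defines : DefinesSingEqOfLevel k Λ Γ M N l

/-- `M` is an eventually periodic module: some syzygy `Ω^n(M)` is nonzero and periodic. -/
def IsEventuallyPeriodicModule (S : Type) [Ring S] (M : ModuleCat.{0} S) : Prop :=
  ∃ (n : ℕ) (Z : ModuleCat.{0} S), IsNthSyzygyOf S n Z M ∧ Nontrivial Z ∧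
    ∃ p : ℕ, 0 < p ∧ ∃ W, IsNthSyzygyOf S p W Z ∧ Nonempty (W ≃ₗ[S] Z)

/-- `Λ` is an eventually periodic algebra: it is eventually periodic as a module over its
enveloping algebra `Λ ⊗[k] Λᵐᵒᵖ`. -/
noncomputable def IsEventuallyPeriodicAlgebra (k Λ : Type) [Field k] [Ring Λ]
    [Algebra k Λ] : Prop :=
  letI := regularBimodule k Λ
  IsEventuallyPeriodicModule (Λ ⊗[k] Λᵐᵒᵖ) (ModuleCat.of (Λ ⊗[k] Λᵐᵒᵖ) Λ)

section Syzygies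

variable {S : Type} [Ring S]

namespace StablyIso

variable {X Y Z : Type} [AddCommGroup X] [Module S X] [AddCommGroup Y] [Module S Y]
  [AddCommGroup Z] [Module S Z]

theorem of_equiv_prod {P Q : Type} [AddCommGroup P] [Module S P] [AddCommGroup Q] [Module S Q]
    [Module.Finite S P] [Module.Projective S P] [Module.Finite S Q] [Module.Projective S Q]
    (e : (X × P) ≃ₗ[S] (Y × Q)) : StablyIso S X Y :=
  ⟨ModuleCat.of S P, ModuleCat.of S Q, ‹_›, ‹_›, ‹_›, ‹_›, ⟨e⟩⟩

theorem of_equiv (e : X ≃ₗ[S] Y) : StablyIso S X Y :=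
  of_equiv_prod (P := PUnit) (Q := PUnit) (e.prodCongr (LinearEquiv.refl S PUnit))

theorem symm (h : StablyIso S X Y) : StablyIso S Y X := by
  obtain ⟨P, Q, hP, hP', hQ, hQ', ⟨e⟩⟩ := h
  exact ⟨Q, P, hQ, hQ', hP, hP', ⟨e.symm⟩⟩

theorem trans (h : StablyIso S X Y) (h' : StablyIso S Y Z) : StablyIso S X Z := by
  obtain ⟨P, Q, _, _, _, _, ⟨e⟩⟩ := h
  obtain ⟨P', Q', _, _, _, _, ⟨e'⟩⟩ := h'
  refine of_equiv_prod (P := P × P') (Q := Q' × Q) ?_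
  refine (LinearEquiv.prodAssoc S X P P').symm ≪≫ₗ e.prodCongr (LinearEquiv.refl S P') ≪≫ₗ
    LinearEquiv.prodAssoc S Y Q P' ≪≫ₗ
    (LinearEquiv.refl S Y).prodCongr (LinearEquiv.prodComm S Q P') ≪≫ₗ
    (LinearEquiv.prodAssoc S Y P' Q).symm ≪≫ₗ e'.prodCongr (LinearEquiv.refl S Q) ≪≫ₗ
    LinearEquiv.prodAssoc S Z Q' Q

end StablyIso

/-- Schanuel's lemma for kernels. -/
theorem schanuel_ker {P Q M : Type} [AddCommGroup P] [Module S P] [AddCommGroup Q] [Module S Q]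
    [AddCommGroup M] [Module S M] [Module.Projective S P] [Module.Projective S Q]
    {p : P →ₗ[S] M} {q : Q →ₗ[S] M} (hp : Function.Surjective p) (hq : Function.Surjective q) :
    Nonempty ((LinearMap.ker p × Q) ≃ₗ[S] (LinearMap.ker q × P)) := by
  obtain ⟨α, hα⟩ := Module.projective_lifting_property q p hq
  obtain ⟨β, hβ⟩ := Module.projective_lifting_property p q hp
  have hα' : ∀ x, q (α x) = p x := fun x => LinearMap.congr_fun hα x
  have hβ' : ∀ y, p (β y) = q y := fun y => LinearMap.congr_fun hβ y
  let f : (LinearMap.ker p × Q) →ₗ[S] P :=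
    (LinearMap.ker p).subtype ∘ₗ LinearMap.fst S _ _ + β ∘ₗ LinearMap.snd S _ _
  let g : (LinearMap.ker q × P) →ₗ[S] Q :=
    (LinearMap.ker q).subtype ∘ₗ LinearMap.fst S _ _ + α ∘ₗ LinearMap.snd S _ _
  have hf : ∀ z, (LinearMap.snd S (LinearMap.ker p) Q - α ∘ₗ f) z ∈ LinearMap.ker q := fun z => by
    simp [f, hα', hβ']
  have hg : ∀ z, (LinearMap.snd S (LinearMap.ker q) P - β ∘ₗ g) z ∈ LinearMap.ker p := fun z => by
    simp [g, hα', hβ']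
  refine ⟨LinearEquiv.ofLinearMap ((LinearMap.codRestrict _ _ hf).prod f)
    ((LinearMap.codRestrict _ _ hg).prod g) ?_ ?_⟩
  · refine LinearMap.ext fun z => Prod.ext (Subtype.ext ?_) ?_ <;> simp [f, g]
  · refine LinearMap.ext fun z => Prod.ext (Subtype.ext ?_) ?_ <;> simp [f, g]

/-- The kernel of `t × id` is the kernel of `t`. -/
def kerProdMapIdEquiv {T N : Type} [AddCommGroup T] [Module S T] [AddCommGroup N] [Module S N]
    (t : T →ₗ[S] N) (T' : Type) [AddCommGroup T'] [Module S T'] :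
    LinearMap.ker t ≃ₗ[S] LinearMap.ker (t.prodMap (LinearMap.id : T' →ₗ[S] T')) where
  toFun z := ⟨(z, 0), by simp⟩
  map_add' x y := by ext <;> simp
  map_smul' c x := by ext <;> simp
  invFun z := ⟨z.1.1, (Prod.mk_eq_zero.1 (LinearMap.mem_ker.1 z.2)).1⟩
  left_inv z := rfl
  right_inv z := Subtype.ext (Prod.ext rfl (Prod.mk_eq_zero.1 (LinearMap.mem_ker.1 z.2)).2.symm)

/-- Kernels of surjections from finitely generated projective modules onto stably isomorphic
modules are stably isomorphic. -/
theorem StablyIso.ker {P Q M M' : Type} [AddCommGroup P] [Module S P] [AddCommGroup Q] [Module S Q]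
    [AddCommGroup M] [Module S M] [AddCommGroup M'] [Module S M']
    [Module.Finite S P] [Module.Projective S P] [Module.Finite S Q] [Module.Projective S Q]
    {p : P →ₗ[S] M} {q : Q →ₗ[S] M'} (hp : Function.Surjective p) (hq : Function.Surjective q)
    (h : StablyIso S M M') : StablyIso S (LinearMap.ker p) (LinearMap.ker q) := by
  obtain ⟨P', Q', _, _, _, _, ⟨e⟩⟩ := h
  have hker : LinearMap.ker (e.toLinearMap ∘ₗ p.prodMap LinearMap.id) =
      LinearMap.ker (p.prodMap (LinearMap.id : P' →ₗ[S] P')) := LinearEquiv.ker_comp _ _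
  obtain ⟨f⟩ := schanuel_ker (p := e.toLinearMap ∘ₗ p.prodMap LinearMap.id)
    (q := q.prodMap (LinearMap.id : Q' →ₗ[S] Q'))
    (e.surjective.comp (Prod.map_surjective.2 ⟨hp, Function.surjective_id⟩))
    (Prod.map_surjective.2 ⟨hq, Function.surjective_id⟩)
  exact (StablyIso.of_equiv (kerProdMapIdEquiv p P' ≪≫ₗ LinearEquiv.ofEq _ _ hker.symm)).trans
    ((StablyIso.of_equiv_prod f).trans (StablyIso.of_equiv (kerProdMapIdEquiv q Q').symm))

namespace IsProjCover

variable {P Q M M' : Type} [AddCommGroup P] [Module S P] [AddCommGroup Q] [Module S Q]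
    [AddCommGroup M] [Module S M] [AddCommGroup M'] [Module S M']

theorem nonempty_ker_equiv {p : P →ₗ[S] M} {q : Q →ₗ[S] M} (hp : IsProjCover S p)
    (hq : IsProjCover S q) : Nonempty (LinearMap.ker p ≃ₗ[S] LinearMap.ker q) := by
  obtain ⟨_, _, hps, hpk⟩ := hp
  obtain ⟨_, _, hqs, hqk⟩ := hq
  obtain ⟨f, hf⟩ := Module.projective_lifting_property q p hqs
  have hf' : ∀ x, q (f x) = p x := fun x => LinearMap.congr_fun hf x
  have hsurj : Function.Surjective f := by
    refine LinearMap.range_eq_top.1 (hqk _ (eq_top_iff.2 fun y _ => ?_))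
    obtain ⟨x, hx⟩ := hps (q y)
    exact Submodule.mem_sup.2 ⟨f x, ⟨x, rfl⟩, y - f x, by simp [hf', hx], by abel⟩
  obtain ⟨g, hg⟩ := Module.projective_lifting_property f LinearMap.id hsurj
  have hg' : ∀ y, f (g y) = y := fun y => LinearMap.congr_fun hg y
  have hgsurj : Function.Surjective g := by
    refine LinearMap.range_eq_top.1 (hpk _ (eq_top_iff.2 fun x _ => ?_))
    exact Submodule.mem_sup.2 ⟨g (f x), ⟨f x, rfl⟩, x - g (f x), by
      rw [LinearMap.mem_ker, ← hf']; simp [hg'], by abel⟩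
  let e : P ≃ₗ[S] Q := LinearEquiv.ofBijective f ⟨fun x y hxy => by
    obtain ⟨a, rfl⟩ := hgsurj x
    obtain ⟨b, rfl⟩ := hgsurj y
    rw [hg', hg'] at hxy
    rw [hxy], hsurj⟩
  refine ⟨e.ofSubmodules _ _ ?_⟩
  ext y
  simp only [Submodule.mem_map, LinearMap.mem_ker]
  constructor
  · rintro ⟨x, hx, rfl⟩
    exact (hf' x).trans hx
  · intro hy
    exact ⟨e.symm y, by rw [← hf']; exact (congrArg q (e.apply_symm_apply y)).trans hy,
      e.apply_symm_apply y⟩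

theorem comp_equiv {p : P →ₗ[S] M} (hp : IsProjCover S p) (e : M ≃ₗ[S] M') :
    IsProjCover S (e.toLinearMap ∘ₗ p) := by
  obtain ⟨h₁, h₂, h₃, h₄⟩ := hp
  refine ⟨h₁, h₂, e.surjective.comp h₃, ?_⟩
  rwa [LinearEquiv.ker_comp]

theorem prodMap_id {p : P →ₗ[S] M} (hp : IsProjCover S p) [Module.Finite S Q]
    [Module.Projective S Q] : IsProjCover S (p.prodMap (LinearMap.id : Q →ₗ[S] Q)) := by
  obtain ⟨_, _, h₃, h₄⟩ := hp
  refine ⟨inferInstance, inferInstance, Prod.map_surjective.2 ⟨h₃, Function.surjective_id⟩,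
    fun L hL => ?_⟩
  have hL' : L.comap (LinearMap.inl S P Q) = ⊤ := by
    refine h₄ _ (eq_top_iff.2 fun x _ => ?_)
    have hx : ((x, 0) : P × Q) ∈ L ⊔ LinearMap.ker (p.prodMap (LinearMap.id : Q →ₗ[S] Q)) := by
      rw [hL]; trivial
    obtain ⟨⟨a, b⟩, ha, ⟨c, d⟩, hc, h⟩ := Submodule.mem_sup.1 hx
    simp only [LinearMap.mem_ker, LinearMap.prodMap_apply, Prod.mk_eq_zero,
      LinearMap.id_apply] at hc
    simp only [Prod.mk_add_mk, Prod.mk.injEq, hc.2, add_zero] at h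
    refine Submodule.mem_sup.2 ⟨a, ?_, c, hc.1, h.1⟩
    simpa [h.2] using ha
  refine eq_top_iff.2 (hL ▸ sup_le le_rfl fun z hz => ?_)
  obtain ⟨c, d⟩ := z
  simp only [LinearMap.mem_ker, LinearMap.prodMap_apply, Prod.mk_eq_zero,
      LinearMap.id_apply] at hz
  have hc : c ∈ L.comap (LinearMap.inl S P Q) := by rw [hL']; trivial
  simpa [hz.2] using hc

theorem nonempty_ker_equiv_of_stablyIso {p : P →ₗ[S] M} {q : Q →ₗ[S] M'} (hp : IsProjCover S p)
    (hq : IsProjCover S q) (h : StablyIso S M M') :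
    Nonempty (LinearMap.ker p ≃ₗ[S] LinearMap.ker q) := by
  obtain ⟨P', Q', _, _, _, _, ⟨e⟩⟩ := h
  obtain ⟨f⟩ := ((hp.prodMap_id (Q := P')).comp_equiv e).nonempty_ker_equiv
    (hq.prodMap_id (Q := Q'))
  exact ⟨kerProdMapIdEquiv p P' ≪≫ₗ LinearEquiv.ofEq _ _ (LinearEquiv.ker_comp _ _).symm ≪≫ₗ f ≪≫ₗ
    (kerProdMapIdEquiv q Q').symm⟩

/-- Over an artinian ring every finitely generated module has a projective cover. -/
theorem exists_of_finite [IsArtinianRing S] (M : Type) [AddCommGroup M] [Module S M]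
    [Module.Finite S M] : ∃ (P : ModuleCat.{0} S) (p : P →ₗ[S] M), IsProjCover S p := by
  let C : Set ℕ∞ := {n | ∃ (P : ModuleCat.{0} S) (p : P →ₗ[S] M), Module.Finite S P ∧
    Module.Projective S P ∧ Function.Surjective p ∧ Module.length S P = n}
  have hC : C.Nonempty := by
    obtain ⟨n, f, hf⟩ := Module.Finite.exists_fin' S M
    exact ⟨_, ModuleCat.of S (Fin n → S), f, inferInstanceAs (Module.Finite S (Fin n → S)),
      inferInstanceAs (Module.Projective S (Fin n → S)), hf, rfl⟩
  obtain ⟨P, p, _, _, hp, hlen⟩ := csInf_mem hC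
  refine ⟨P, p, ‹_›, ‹_›, hp, fun L hL => ?_⟩
  have hpL : Function.Surjective (p ∘ₗ L.subtype) := fun m => by
    obtain ⟨x, rfl⟩ := hp m
    have hx : x ∈ L ⊔ LinearMap.ker p := by rw [hL]; trivial
    obtain ⟨a, ha, b, hb, rfl⟩ := Submodule.mem_sup.1 hx
    exact ⟨⟨a, ha⟩, by simp [LinearMap.mem_ker.1 hb]⟩
  obtain ⟨f, hf⟩ := Module.projective_lifting_property (p ∘ₗ L.subtype) p hpL
  let g : Module.End S P := L.subtype ∘ₗ f
  have hg : ∀ x, p (g x) = p x := fun x => LinearMap.congr_fun hf x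
  have hgn : ∀ n x, p ((g ^ n) x) = p x := by
    intro n
    induction n with
    | zero => simp
    | succ n ih => intro x; rw [pow_succ', Module.End.mul_apply, hg, ih]
  obtain ⟨n, hn⟩ := Filter.eventually_atTop.1 g.eventually_isCompl_ker_pow_range_pow
  have hcompl := hn (n + 1) (Nat.le_succ n)
  set R := LinearMap.range (g ^ (n + 1)) with hR
  have hproj : Module.Projective S R := by
    refine Module.Projective.of_split R.subtype
      (Submodule.projectionOnto _ _ hcompl.symm) ?_
    exact LinearMap.ext fun x => Submodule.projectionOnto_apply_left hcompl.symm x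
  have hRsurj : Function.Surjective (p ∘ₗ R.subtype) := fun m => by
    obtain ⟨x, rfl⟩ := hp m
    exact ⟨⟨(g ^ (n + 1)) x, x, rfl⟩, by simpa using hgn (n + 1) x⟩
  have hmin : Module.length S P ≤ Module.length S R := by
    rw [hlen]
    exact csInf_le' ⟨ModuleCat.of S R, p ∘ₗ R.subtype, inferInstanceAs (Module.Finite S R),
      hproj, hRsurj, rfl⟩
  have hRtop : R = ⊤ := by
    by_contra h
    exact (Submodule.length_lt h).not_ge hmin
  refine eq_top_iff.2 (hRtop ▸ ?_)
  rintro _ ⟨x, rfl⟩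
  rw [pow_succ', Module.End.mul_apply]
  exact (f ((g ^ n) x)).2

end IsProjCover

end Syzygies

section NthSyzygies

variable {S : Type} [Ring S]

theorem IsSyzygyOf.nonempty_equiv {Z M Z' M' : ModuleCat.{0} S} (h : IsSyzygyOf S Z M)
    (h' : IsSyzygyOf S Z' M') (e : StablyIso S M M') : Nonempty (Z ≃ₗ[S] Z') := by
  obtain ⟨P, p, hp, ⟨f⟩⟩ := h
  obtain ⟨P', p', hp', ⟨f'⟩⟩ := h'
  obtain ⟨g⟩ := hp.nonempty_ker_equiv_of_stablyIso hp' e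
  exact ⟨f ≪≫ₗ g ≪≫ₗ f'.symm⟩

theorem IsSyzygyOf.subsingleton {Z M : ModuleCat.{0} S} (h : IsSyzygyOf S Z M)
    (hM : Subsingleton M) : Subsingleton Z := by
  obtain ⟨P, p, ⟨_, _, _, hp⟩, ⟨f⟩⟩ := h
  have : (⊥ : Submodule S P) = ⊤ := hp ⊥ <| by
    rw [bot_sup_eq, eq_top_iff]
    exact fun x _ => Subsingleton.elim _ _
  have : Subsingleton P := (Submodule.subsingleton_iff S).1 (subsingleton_of_bot_eq_top this)
  exact f.toEquiv.subsingleton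

theorem IsSyzygyOf.exists_of_finite [IsArtinianRing S] (M : ModuleCat.{0} S) [Module.Finite S M] :
    ∃ Z : ModuleCat.{0} S, Module.Finite S Z ∧ IsSyzygyOf S Z M := by
  obtain ⟨P, p, hp⟩ := IsProjCover.exists_of_finite (S := S) M
  have := hp.1
  exact ⟨ModuleCat.of S (LinearMap.ker p), inferInstanceAs (Module.Finite S (LinearMap.ker p)),
    P, p, hp, ⟨LinearEquiv.refl S _⟩⟩

namespace IsNthSyzygyOf

theorem nonempty_equiv {n : ℕ} : ∀ {Z M Z' M' : ModuleCat.{0} S}, IsNthSyzygyOf S n Z M →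
    IsNthSyzygyOf S n Z' M' → Nonempty (M ≃ₗ[S] M') → Nonempty (Z ≃ₗ[S] Z') := by
  induction n with
  | zero =>
    rintro Z M Z' M' ⟨e⟩ ⟨e'⟩ ⟨f⟩
    exact ⟨e ≪≫ₗ f ≪≫ₗ e'.symm⟩
  | succ n ih =>
    rintro Z M Z' M' ⟨W, hW, hZ⟩ ⟨W', hW', hZ'⟩ f
    obtain ⟨g⟩ := ih hW hW' f
    exact hZ.nonempty_equiv hZ' (.of_equiv g)

theorem of_equiv {n : ℕ} {Z Z' M : ModuleCat.{0} S} (h : IsNthSyzygyOf S n Z M)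
    (e : Z' ≃ₗ[S] Z) : IsNthSyzygyOf S n Z' M := by
  cases n with
  | zero =>
    obtain ⟨f⟩ := h
    exact ⟨e ≪≫ₗ f⟩
  | succ n =>
    obtain ⟨W, hW, P, p, hp, ⟨f⟩⟩ := h
    exact ⟨W, hW, P, p, hp, ⟨e ≪≫ₗ f⟩⟩

theorem trans {n m : ℕ} : ∀ {W Z M : ModuleCat.{0} S}, IsNthSyzygyOf S n Z M →
    IsNthSyzygyOf S m W Z → IsNthSyzygyOf S (n + m) W M := by
  induction m with
  | zero =>
    rintro W Z M h ⟨e⟩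
    exact h.of_equiv e
  | succ m ih =>
    rintro W Z M h ⟨V, hV, hW⟩
    exact ⟨V, ih h hV, hW⟩

theorem of_base_equiv {n : ℕ} {Z M M' : ModuleCat.{0} S} (e : M ≃ₗ[S] M') :
    IsNthSyzygyOf S n Z M → IsNthSyzygyOf S n Z M' := by
  induction n generalizing Z with
  | zero => exact fun ⟨f⟩ => ⟨f ≪≫ₗ e⟩
  | succ n ih => exact fun ⟨W, hW, hZ⟩ => ⟨W, ih hW, hZ⟩

theorem exists_of_add {n m : ℕ} {W M : ModuleCat.{0} S} (h : IsNthSyzygyOf S (n + m) W M) :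
    ∃ Z, IsNthSyzygyOf S n Z M ∧ IsNthSyzygyOf S m W Z := by
  induction m generalizing W with
  | zero => exact ⟨W, h, ⟨LinearEquiv.refl S W⟩⟩
  | succ m ih =>
    obtain ⟨V, hV, hW⟩ := h
    obtain ⟨Z, hZ, hV⟩ := ih hV
    exact ⟨Z, hZ, V, hV, hW⟩

theorem exists_of_finite [IsArtinianRing S] (n : ℕ) (M : ModuleCat.{0} S) [Module.Finite S M] :
    ∃ Z : ModuleCat.{0} S, Module.Finite S Z ∧ IsNthSyzygyOf S n Z M := by
  induction n with
  | zero => exact ⟨M, ‹_›, ⟨LinearEquiv.refl S M⟩⟩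
  | succ n ih =>
    obtain ⟨Z, _, hZ⟩ := ih
    obtain ⟨Z', hZ', h⟩ := IsSyzygyOf.exists_of_finite Z
    exact ⟨Z', hZ', Z, hZ, h⟩

end IsNthSyzygyOf

end NthSyzygies

section Transfer

/-- Isomorphisms between, and vanishing of, syzygies of `M` pass to the syzygies of `M'` whose
degrees are shifted by `d`. -/
def SyzygyTransfer (A B : Type) [Ring A] [Ring B] (M : ModuleCat.{0} A) (M' : ModuleCat.{0} B)
    (d : ℕ) : Prop :=
  (∀ (i j : ℕ) (Z Z' : ModuleCat.{0} A) (W W' : ModuleCat.{0} B),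
    IsNthSyzygyOf A i Z M → IsNthSyzygyOf A j Z' M → IsNthSyzygyOf B (d + i) W M' →
    IsNthSyzygyOf B (d + j) W' M' → Nonempty (Z ≃ₗ[A] Z') → Nonempty (W ≃ₗ[B] W')) ∧
  ∀ (i : ℕ) (Z : ModuleCat.{0} A) (W : ModuleCat.{0} B), IsNthSyzygyOf A i Z M →
    IsNthSyzygyOf B (d + i) W M' → Subsingleton Z → Subsingleton W

section Periodicity

variable {S : Type} [Ring S] {M : ModuleCat.{0} S} {ω : ℕ → ModuleCat.{0} S}

theorem nonempty_equiv_add (hω : ∀ i, IsNthSyzygyOf S i (ω i) M) {i j : ℕ}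
    (h : Nonempty (ω i ≃ₗ[S] ω j)) (s : ℕ) : Nonempty (ω (i + s) ≃ₗ[S] ω (j + s)) := by
  induction s with
  | zero => exact h
  | succ s ih =>
    obtain ⟨e⟩ := ih
    obtain ⟨W, hW, hZ⟩ := hω (i + (s + 1))
    obtain ⟨W', hW', hZ'⟩ := hω (j + (s + 1))
    obtain ⟨f⟩ := hW.nonempty_equiv (hω (i + s)) ⟨LinearEquiv.refl S M⟩
    obtain ⟨f'⟩ := hW'.nonempty_equiv (hω (j + s)) ⟨LinearEquiv.refl S M⟩
    exact hZ.nonempty_equiv hZ' (.of_equiv (f ≪≫ₗ e ≪≫ₗ f'.symm))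

theorem nonempty_equiv_add_mul (hω : ∀ i, IsNthSyzygyOf S i (ω i) M) {i p : ℕ}
    (h : Nonempty (ω i ≃ₗ[S] ω (i + p))) (t : ℕ) : Nonempty (ω i ≃ₗ[S] ω (i + p * t)) := by
  induction t with
  | zero => exact ⟨LinearEquiv.refl S _⟩
  | succ t ih =>
    obtain ⟨e⟩ := h
    obtain ⟨f⟩ := nonempty_equiv_add hω ih p
    rw [show i + p * (t + 1) = i + p * t + p by ring]
    exact ⟨e ≪≫ₗ f⟩

theorem subsingleton_of_le (hω : ∀ i, IsNthSyzygyOf S i (ω i) M) {i j : ℕ} (hij : i ≤ j)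
    (h : Subsingleton (ω i)) : Subsingleton (ω j) := by
  induction j, hij using Nat.le_induction with
  | base => exact h
  | succ j _ ih =>
    obtain ⟨W, hW, hZ⟩ := hω (j + 1)
    obtain ⟨f⟩ := hW.nonempty_equiv (hω j) ⟨LinearEquiv.refl S M⟩
    exact hZ.subsingleton f.toEquiv.subsingleton

/-- Periodicity of a syzygy of `M` in terms of a chosen sequence of syzygies of `M`. -/
theorem exists_syzygy_equiv_iff (hω : ∀ i, IsNthSyzygyOf S i (ω i) M) {n p : ℕ}
    {Z : ModuleCat.{0} S} (hZ : IsNthSyzygyOf S n Z M) :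
    (∃ W, IsNthSyzygyOf S p W Z ∧ Nonempty (W ≃ₗ[S] Z)) ↔
      Nonempty (ω n ≃ₗ[S] ω (n + p)) := by
  obtain ⟨e⟩ := hZ.nonempty_equiv (hω n) ⟨LinearEquiv.refl S M⟩
  constructor
  · rintro ⟨W, hW, ⟨f⟩⟩
    obtain ⟨g⟩ := (hZ.trans hW).nonempty_equiv (hω (n + p)) ⟨LinearEquiv.refl S M⟩
    exact ⟨e.symm ≪≫ₗ f.symm ≪≫ₗ g⟩
  · rintro ⟨f⟩
    obtain ⟨V, hV, h⟩ := (hω (n + p)).exists_of_add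
    obtain ⟨g⟩ := hV.nonempty_equiv hZ ⟨LinearEquiv.refl S M⟩
    exact ⟨ω (n + p), h.of_base_equiv g, ⟨f.symm ≪≫ₗ e.symm⟩⟩

end Periodicity

variable {A B : Type} [Ring A] [Ring B] {M : ModuleCat.{0} A} {M' : ModuleCat.{0} B}
  {ω : ℕ → ModuleCat.{0} A} {ω' : ℕ → ModuleCat.{0} B}

namespace SyzygyTransfer

theorem isEventuallyPeriodicModule {d d' : ℕ} (hT : SyzygyTransfer A B M M' d)
    (hT' : SyzygyTransfer B A M' M d') (hω : ∀ i, IsNthSyzygyOf A i (ω i) M)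
    (hω' : ∀ i, IsNthSyzygyOf B i (ω' i) M') (h : IsEventuallyPeriodicModule A M) :
    IsEventuallyPeriodicModule B M' := by
  obtain ⟨n, Z, hZ, hZ0, p, hp, hper⟩ := h
  have hper := (exists_syzygy_equiv_iff hω hZ).1 hper
  obtain ⟨eZ⟩ := hZ.nonempty_equiv (hω n) ⟨LinearEquiv.refl A M⟩
  refine ⟨d + n, ω' (d + n), hω' _, ?_, p, hp, (exists_syzygy_equiv_iff hω' (hω' _)).2
    (hT.1 n (n + p) _ _ _ _ (hω _) (hω _) (hω' _) (add_assoc d n p ▸ hω' _) hper)⟩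
  by_contra h0
  have h1 := hT'.2 (d + n) _ _ (hω' _) (hω _) (not_nontrivial_iff_subsingleton.1 h0)
  have hle : d' + (d + n) ≤ n + p * (d' + d) := by nlinarith
  have h2 := subsingleton_of_le hω hle h1
  obtain ⟨f⟩ := nonempty_equiv_add_mul hω hper (d' + d)
  exact not_subsingleton Z (eZ ≪≫ₗ f).toEquiv.subsingleton

theorem period_le {d : ℕ} (hT : SyzygyTransfer A B M M' d)
    (hω : ∀ i, IsNthSyzygyOf A i (ω i) M) (hω' : ∀ i, IsNthSyzygyOf B i (ω' i) M')
    {n m p q : ℕ} {Z : ModuleCat.{0} A} {W : ModuleCat.{0} B} (hZ : IsNthSyzygyOf A n Z M)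
    (hZp : IsPeriodicWithPeriod A Z p) (hW : IsNthSyzygyOf B m W M')
    (hWq : IsPeriodicWithPeriod B W q) : q ≤ p := by
  obtain ⟨hp, hper, -⟩ := hZp
  obtain ⟨hq, hper', hmin⟩ := hWq
  refine hmin p hp ((exists_syzygy_equiv_iff hω' hW).2 ?_)
  have hper := (exists_syzygy_equiv_iff hω hZ).1 hper
  have hper' := (exists_syzygy_equiv_iff hω' hW).1 hper'
  have h := hT.1 n (n + p) _ _ _ _ (hω _) (hω _) (hω' _) (hω' _) hper
  obtain ⟨s, hs⟩ : ∃ s, m + q * (d + n) = d + n + s := Nat.exists_eq_add_of_le (by nlinarith)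
  obtain ⟨e⟩ := nonempty_equiv_add_mul hω' hper' (d + n)
  obtain ⟨f⟩ := nonempty_equiv_add hω' ⟨e⟩ p
  obtain ⟨g⟩ := nonempty_equiv_add hω' h s
  rw [show d + (n + p) + s = m + q * (d + n) + p by omega, ← hs] at g
  exact ⟨e ≪≫ₗ g ≪≫ₗ f.symm⟩

end SyzygyTransfer

end Transfer

section DualBasis

/-- A finite dual basis of the `S`-module `P`. -/
def IsDualBasis {S P ι : Type} [Ring S] [AddCommGroup P] [Module S P] [Fintype ι]
    (x : ι → P) (f : ι → P →ₗ[S] S) : Prop :=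
  ∀ v, ∑ i, f i v • x i = v

variable {S P : Type} [Ring S] [AddCommGroup P] [Module S P]

theorem IsDualBasis.finite {ι : Type} [Fintype ι] {x : ι → P} {f : ι → P →ₗ[S] S}
    (h : IsDualBasis x f) : Module.Finite S P :=
  Module.Finite.of_surjective (Fintype.linearCombination S x) fun v => ⟨fun i => f i v, by
    simpa [Fintype.linearCombination_apply] using h v⟩

theorem IsDualBasis.projective {ι : Type} [Fintype ι] {x : ι → P} {f : ι → P →ₗ[S] S}
    (h : IsDualBasis x f) : Module.Projective S P :=
  Module.Projective.of_split (LinearMap.pi f) (Fintype.linearCombination S x) <|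
    LinearMap.ext fun v => by simpa [Fintype.linearCombination_apply] using h v

theorem exists_isDualBasis (S P : Type) [Ring S] [AddCommGroup P] [Module S P] [Module.Finite S P]
    [Module.Projective S P] :
    ∃ (n : ℕ) (x : Fin n → P) (f : Fin n → P →ₗ[S] S), IsDualBasis x f := by
  obtain ⟨n, f, g, -, -, hfg⟩ := Module.Finite.exists_comp_eq_id_of_projective S P
  refine ⟨n, fun i => f (Pi.single i 1), fun i => LinearMap.proj i ∘ₗ g, fun v => ?_⟩
  conv_rhs => rw [← LinearMap.id_apply (R := S) v, ← hfg, LinearMap.comp_apply,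
    pi_eq_sum_univ' (g v), map_sum]
  refine Finset.sum_congr rfl fun i _ => ?_
  rw [← map_smul]
  rfl

end DualBasis

section RTensor

variable (A B : Type) [Ring A] [Ring B] (U : Type) [AddCommGroup U] [Module B U] [Module Aᵐᵒᵖ U]
  (X : Type) [AddCommGroup X] [Module A X]

/-- The `B`-submodule of `U ⊗ X` generated by the `A`-balancing relations. -/
def rTensorRel : Submodule B (U ⊗[ℤ] X) :=
  Submodule.span B {z | ∃ (u : U) (a : A) (x : X), z = (op a • u) ⊗ₜ[ℤ] x - u ⊗ₜ[ℤ] (a • x)}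

/-- The tensor product `U ⊗_A X` of a `(B, A)`-bimodule `U` and a left `A`-module `X`, as a left
`B`-module. -/
abbrev RTensor : Type := (U ⊗[ℤ] X) ⧸ rTensorRel A B U X

namespace RTensor

variable {U X}

/-- The pure tensor `u ⊗ x`. -/
def mk (u : U) (x : X) : RTensor A B U X := Submodule.Quotient.mk (u ⊗ₜ[ℤ] x)

variable {A B}

theorem mk_add_left (u v : U) (x : X) : mk A B (u + v) x = mk A B u x + mk A B v x := by
  simp only [mk, TensorProduct.add_tmul, Submodule.Quotient.mk_add]

theorem mk_add_right (u : U) (x y : X) : mk A B u (x + y) = mk A B u x + mk A B u y := by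
  simp only [mk, TensorProduct.tmul_add, Submodule.Quotient.mk_add]

theorem mk_op_smul (u : U) (a : A) (x : X) : mk A B (op a • u) x = mk A B u (a • x) :=
  (Submodule.Quotient.eq _).2 (Submodule.subset_span ⟨u, a, x, rfl⟩)

theorem mk_sum_left {ι : Type} (s : Finset ι) (u : ι → U) (x : X) :
    mk A B (∑ i ∈ s, u i) x = ∑ i ∈ s, mk A B (u i) x :=
  map_sum (AddMonoidHom.mk' (fun u => mk A B u x) fun u v => mk_add_left u v x) u s

theorem mk_sum_right {ι : Type} (s : Finset ι) (u : U) (x : ι → X) :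
    mk A B u (∑ i ∈ s, x i) = ∑ i ∈ s, mk A B u (x i) :=
  map_sum (AddMonoidHom.mk' (fun x => mk A B u x) fun x y => mk_add_right u x y) x s

theorem mk_zero_right (u : U) : mk A B u (0 : X) = 0 :=
  map_zero (AddMonoidHom.mk' (fun x : X => mk A B u x) fun x y => mk_add_right u x y)

@[elab_as_elim]
theorem induction_on {p : RTensor A B U X → Prop} (z : RTensor A B U X)
    (h0 : p 0) (hmk : ∀ u x, p (mk A B u x)) (hadd : ∀ y z, p y → p z → p (y + z)) : p z := by
  obtain ⟨z, rfl⟩ := Submodule.Quotient.mk_surjective _ z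
  induction z with
  | zero => exact h0
  | tmul u x => exact hmk u x
  | add y z hy hz => exact hadd _ _ hy hz

variable [SMulCommClass B Aᵐᵒᵖ U]

/-- The additive map on `U ⊗_A X` induced by an `A`-balanced biadditive map. -/
def liftAdd {Y : Type} [AddCommGroup Y] (f : U →+ X →+ Y)
    (hf : ∀ (u : U) (a : A) (x : X), f (op a • u) x = f u (a • x)) : RTensor A B U X →+ Y :=
  QuotientAddGroup.lift (rTensorRel A B U X).toAddSubgroup
    (TensorProduct.liftAddHom f fun r u x => by simp) <| by
    intro z hz
    suffices h : ∀ b : B, TensorProduct.liftAddHom (R := ℤ) f (fun r u x => by simp) (b • z) = 0 by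
      simpa using h 1
    refine Submodule.span_induction ?_ ?_ ?_ ?_ hz
    · rintro _ ⟨u, a, x, rfl⟩ b
      rw [smul_sub, TensorProduct.smul_tmul', TensorProduct.smul_tmul', map_sub,
        TensorProduct.liftAddHom_tmul, TensorProduct.liftAddHom_tmul, smul_comm, hf, sub_self]
    · simp
    · intro x y _ _ hx hy b
      rw [smul_add, map_add, hx, hy, add_zero]
    · intro c x _ hx b
      rw [smul_smul]
      exact hx _

/-- The `B`-linear map on `U ⊗_A X` induced by an `A`-balanced biadditive map that is `B`-linear
in the first variable. -/
def lift {Y : Type} [AddCommGroup Y] [Module B Y] (f : U →+ X →+ Y)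
    (hf : ∀ (u : U) (a : A) (x : X), f (op a • u) x = f u (a • x))
    (hB : ∀ (b : B) (u : U) (x : X), f (b • u) x = b • f u x) : RTensor A B U X →ₗ[B] Y where
  __ := liftAdd f hf
  map_smul' b z := by
    refine induction_on z ?_ ?_ ?_
    · simp
    · intro u x
      exact hB b u x
    · intro y z hy hz
      simp_all

variable {X' X'' : Type} [AddCommGroup X'] [Module A X'] [AddCommGroup X''] [Module A X'']

variable (B U) in
/-- Functoriality of `U ⊗_A X` in `X`. -/
def map (g : X →ₗ[A] X') : RTensor A B U X →ₗ[B] RTensor A B U X' :=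
  lift (AddMonoidHom.mk' (fun u => AddMonoidHom.mk' (fun x => mk A B u (g x)) fun x y => by
      rw [map_add, mk_add_right]) fun u v => by ext x; exact mk_add_left u v (g x))
    (fun u a x => by
      simp only [AddMonoidHom.mk'_apply, map_smul]
      exact mk_op_smul u a (g x))
    (fun b u x => rfl)

theorem map_mk (g : X →ₗ[A] X') (u : U) (x : X) : map B U g (mk A B u x) = mk A B u (g x) := rfl

theorem map_map (g : X →ₗ[A] X') (g' : X' →ₗ[A] X'') (z : RTensor A B U X) :
    map B U g' (map B U g z) = map B U (g' ∘ₗ g) z :=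
  induction_on z (by simp) (fun _ _ => rfl) fun y z hy hz => by simp [hy, hz]

theorem map_id (z : RTensor A B U X) : map B U LinearMap.id z = z :=
  induction_on z (by simp) (fun _ _ => rfl) fun y z hy hz => by simp [hy, hz]

variable (B U) in
/-- `U ⊗_A X` and `U ⊗_A X'` are isomorphic for isomorphic `X` and `X'`. -/
def congr (e : X ≃ₗ[A] X') : RTensor A B U X ≃ₗ[B] RTensor A B U X' :=
  LinearEquiv.ofLinearMap (map B U e.toLinearMap) (map B U e.symm.toLinearMap)
    (LinearMap.ext fun z => by simp [map_map, map_id])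
    (LinearMap.ext fun z => by simp [map_map, map_id])

theorem map_surjective {g : X →ₗ[A] X'} (hg : Function.Surjective g) :
    Function.Surjective (map B U g) := fun z =>
  induction_on z ⟨0, map_zero _⟩
    (fun u x => by
      obtain ⟨y, rfl⟩ := hg x
      exact ⟨mk A B u y, rfl⟩)
    fun _ _ ⟨y, hy⟩ ⟨z, hz⟩ => ⟨y + z, by rw [map_add, hy, hz]⟩

instance [Subsingleton X] : Subsingleton (RTensor A B U X) :=
  subsingleton_of_forall_eq 0 fun z => induction_on z rfl
    (fun u x => by rw [Subsingleton.elim x 0, mk_zero_right]) fun y z hy hz => by simp [hy, hz]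

/-- The additive map `U ⊗_A X → X` induced by a functional on the right `A`-module `U`. -/
def coord (φ : U →ₗ[Aᵐᵒᵖ] Aᵐᵒᵖ) : RTensor A B U X →+ X :=
  liftAdd (AddMonoidHom.mk' (fun u => AddMonoidHom.mk' (fun x => unop (φ u) • x)
      fun x y => smul_add _ _ _) fun u v => by ext x; simp [add_smul])
    (fun u a x => by simp [mul_smul])

theorem coord_mk (φ : U →ₗ[Aᵐᵒᵖ] Aᵐᵒᵖ) (u : U) (x : X) :
    coord φ (mk A B u x) = unop (φ u) • x := rfl

theorem coord_map (φ : U →ₗ[Aᵐᵒᵖ] Aᵐᵒᵖ) (g : X →ₗ[A] X') (z : RTensor A B U X) :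
    coord φ (map B U g z) = g (coord φ z) :=
  induction_on z (by simp) (fun u x => by simp [map_mk, coord_mk])
    fun y z hy hz => by simp [hy, hz]

theorem sum_mk_coord {ι : Type} [Fintype ι] {v : ι → U} {φ : ι → U →ₗ[Aᵐᵒᵖ] Aᵐᵒᵖ}
    (h : IsDualBasis v φ) (z : RTensor A B U X) : ∑ i, mk A B (v i) (coord (φ i) z) = z := by
  refine induction_on z (by simp [mk_zero_right]) (fun u x => ?_) fun y z hy hz => ?_
  · conv_rhs => rw [← h u, mk_sum_left]
    exact Finset.sum_congr rfl fun i _ => (mk_op_smul (v i) (unop (φ i u)) x).symm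
  · simp [mk_add_right, Finset.sum_add_distrib, hy, hz]

section Flat

variable [Module.Finite Aᵐᵒᵖ U] [Module.Projective Aᵐᵒᵖ U]

theorem map_injective {g : X →ₗ[A] X'} (hg : Function.Injective g) :
    Function.Injective (map B U g) := by
  obtain ⟨n, v, φ, h⟩ := exists_isDualBasis Aᵐᵒᵖ U
  intro y z hyz
  rw [← sum_mk_coord h y, ← sum_mk_coord h z]
  refine Finset.sum_congr rfl fun i _ => ?_
  have : coord (φ i) y = coord (φ i) z := hg <| by rw [← coord_map, ← coord_map, hyz]
  rw [this]

theorem map_exact {g : X →ₗ[A] X'} {g' : X' →ₗ[A] X''} (hg : Function.Exact g g') :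
    Function.Exact (map B U g) (map B U g') := by
  obtain ⟨n, v, φ, h⟩ := exists_isDualBasis Aᵐᵒᵖ U
  intro z
  constructor
  · intro hz
    have : ∀ i, ∃ x, g x = coord (φ i) z := fun i => (hg _).1 <| by
      rw [← coord_map, hz, map_zero]
    choose x hx using this
    exact ⟨∑ i, mk A B (v i) (x i), by simp [map_mk, hx, sum_mk_coord h]⟩
  · rintro ⟨y, rfl⟩
    rw [map_map, hg.linearMap_comp_eq_zero]
    exact induction_on y (by simp) (fun u x => mk_zero_right u) fun y z hy hz => by simp [hy, hz]

variable (B U) in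
theorem nonempty_equiv_ker {X X' X'' : Type} [AddCommGroup X] [Module A X] [AddCommGroup X']
    [Module A X'] [AddCommGroup X''] [Module A X''] {p : X' →ₗ[A] X''}
    (e : X ≃ₗ[A] LinearMap.ker p) :
    Nonempty (RTensor A B U X ≃ₗ[B] LinearMap.ker (map B U p)) := by
  let i : X →ₗ[A] X' := (LinearMap.ker p).subtype ∘ₗ e.toLinearMap
  have hi : Function.Injective i := (Submodule.injective_subtype _).comp e.injective
  have hip : Function.Exact i p := LinearMap.exact_iff.2 <| by
    simp [i, LinearMap.range_comp]
  exact ⟨LinearEquiv.ofInjective _ (map_injective (B := B) (U := U) hi) ≪≫ₗ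
    LinearEquiv.ofEq _ _ (LinearMap.exact_iff.1 (map_exact (B := B) (U := U) hip)).symm⟩

end Flat

/-- A functional on `U ⊗_A P` built from functionals on `U` and `P`. -/
def functional (ψ : U →ₗ[B] B) (f : X →ₗ[A] A) : RTensor A B U X →ₗ[B] B :=
  lift (AddMonoidHom.mk' (fun u => AddMonoidHom.mk' (fun x => ψ (op (f x) • u))
      fun x y => by simp [add_smul]) fun u v => by ext x; simp)
    (fun u a x => by simp [← mul_smul]) fun b u x => by simp [← smul_comm b]

theorem finite_and_projective [Module.Finite B U] [Module.Projective B U] [Module.Finite A X]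
    [Module.Projective A X] :
    Module.Finite B (RTensor A B U X) ∧ Module.Projective B (RTensor A B U X) := by
  obtain ⟨n, v, ψ, hU⟩ := exists_isDualBasis B U
  obtain ⟨m, x, f, hX⟩ := exists_isDualBasis A X
  have h : IsDualBasis (fun ij : Fin m × Fin n => mk A B (v ij.2) (x ij.1))
      (fun ij => functional (ψ ij.2) (f ij.1)) := fun z => by
    refine induction_on z (by simp) (fun u y => ?_) fun y z hy hz => ?_
    · conv_rhs => rw [← hX y, mk_sum_right]
      rw [Fintype.sum_prod_type]
      refine Finset.sum_congr rfl fun i _ => ?_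
      rw [← mk_op_smul, ← hU (op (f i y) • u), mk_sum_left]
      refine Finset.sum_congr rfl fun j _ => ?_
      rfl
    · simp [add_smul, Finset.sum_add_distrib, hy, hz]
  exact ⟨h.finite, h.projective⟩

end RTensor

end RTensor

section TensorTransfer

variable {A B : Type} [Ring A] [Ring B] (U : Type) [AddCommGroup U] [Module B U] [Module Aᵐᵒᵖ U]
  [SMulCommClass B Aᵐᵒᵖ U] [Module.Finite Aᵐᵒᵖ U] [Module.Projective Aᵐᵒᵖ U]
  [Module.Finite B U] [Module.Projective B U]

/-- Tensoring with a bimodule that is finitely generated projective on both sides commutes with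
syzygies up to stable isomorphism. -/
theorem StablyIso.rTensor_syzygy {X : ModuleCat.{0} A} {Y : ModuleCat.{0} B}
    (h : StablyIso B (RTensor A B U X) Y) {n : ℕ} {Z : ModuleCat.{0} A} {W : ModuleCat.{0} B}
    (hZ : IsNthSyzygyOf A n Z X) (hW : IsNthSyzygyOf B n W Y) :
    StablyIso B (RTensor A B U Z) W := by
  induction n generalizing Z W with
  | zero =>
    obtain ⟨e⟩ := hZ
    obtain ⟨f⟩ := hW
    exact ((StablyIso.of_equiv (RTensor.congr B U e)).trans h).trans (.of_equiv f.symm)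
  | succ n ih =>
    obtain ⟨Z', hZ', P, p, ⟨_, _, hp, -⟩, ⟨e⟩⟩ := hZ
    obtain ⟨W', hW', Q, q, ⟨_, _, hq, -⟩, ⟨f⟩⟩ := hW
    obtain ⟨g⟩ := RTensor.nonempty_equiv_ker B U e
    obtain ⟨_, _⟩ := RTensor.finite_and_projective (A := A) (B := B) (U := U) (X := P)
    exact ((StablyIso.of_equiv g).trans
      (StablyIso.ker (RTensor.map_surjective hp) hq (ih hZ' hW'))).trans (.of_equiv f.symm)

theorem SyzygyTransfer.of_stablyIso_rTensor {X : ModuleCat.{0} A} {Y Y' : ModuleCat.{0} B} {l : ℕ}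
    (hY : IsNthSyzygyOf B l Y Y') (h : StablyIso B (RTensor A B U X) Y) :
    SyzygyTransfer A B X Y' (l + 1) := by
  have key : ∀ {i : ℕ} {Z : ModuleCat.{0} A} {W : ModuleCat.{0} B}, IsNthSyzygyOf A i Z X →
      IsNthSyzygyOf B (l + 1 + i) W Y' →
      ∃ V, IsSyzygyOf B W V ∧ StablyIso B (RTensor A B U Z) V := by
    intro i Z W hZ hW
    rw [show l + 1 + i = l + i + 1 by omega] at hW
    obtain ⟨V, hV, hWV⟩ := hW
    obtain ⟨Y₁, hY₁, hV⟩ := hV.exists_of_add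
    obtain ⟨e⟩ := hY₁.nonempty_equiv hY ⟨LinearEquiv.refl B Y'⟩
    exact ⟨V, hWV, h.rTensor_syzygy U hZ (hV.of_base_equiv e)⟩
  constructor
  · rintro i j Z Z' W W' hZ hZ' hW hW' ⟨e⟩
    obtain ⟨V, hWV, hV⟩ := key hZ hW
    obtain ⟨V', hWV', hV'⟩ := key hZ' hW'
    exact hWV.nonempty_equiv hWV'
      ((hV.symm.trans (.of_equiv (RTensor.congr B U e))).trans hV')
  · intro i Z W hZ hW hZ0
    obtain ⟨V, ⟨P, p, hp, ⟨e⟩⟩, hV⟩ := key hZ hW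
    have h0 : IsProjCover B (LinearMap.id : PUnit →ₗ[B] PUnit) :=
      ⟨inferInstance, inferInstance, Function.surjective_id, fun L _ => Subsingleton.elim _ _⟩
    have h1 : StablyIso B V PUnit :=
      hV.symm.trans (.of_equiv (0 : RTensor A B U Z ≃ₗ[B] PUnit))
    obtain ⟨f⟩ := hp.nonempty_ker_equiv_of_stablyIso h0 h1
    exact (e ≪≫ₗ f).toEquiv.subsingleton

end TensorTransfer

section OneSidedDualBasis

variable (k : Type) [Field k] {A B : Type} [Ring A] [Ring B] [Algebra k A] [Algebra k B]
variable {X : Type} [AddCommGroup X] [Module k X] [Module (A ⊗[k] Bᵐᵒᵖ) X]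
  [IsScalarTower k (A ⊗[k] Bᵐᵒᵖ) X]

theorem exists_left_dualBasis
    (h : letI := leftRestrict k A B X; Module.Finite A X ∧ Module.Projective A X) :
    ∃ (n : ℕ) (x : Fin n → X) (f : Fin n → X →ₗ[k] A),
      (∀ i a v, f i ((a ⊗ₜ[k] (1 : Bᵐᵒᵖ)) • v) = a * f i v) ∧
      ∀ v, ∑ i, (f i v ⊗ₜ[k] (1 : Bᵐᵒᵖ)) • x i = v := by
  let := leftRestrict k A B X
  obtain ⟨_, _⟩ := h
  obtain ⟨n, x, f, hf⟩ := exists_isDualBasis A X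
  refine ⟨n, x, fun i => { (f i).toAddMonoidHom with
    map_smul' := fun c v => ?_ }, fun i a v => (f i).map_smul a v, hf⟩
  have hc : c • v = algebraMap k A c • v := by
    rw [← algebraMap_smul (A ⊗[k] Bᵐᵒᵖ) c v]
    rfl
  change f i (c • v) = c • f i v
  rw [hc, map_smul, smul_eq_mul, Algebra.smul_def]

theorem exists_right_dualBasis
    (h : letI := rightRestrict k A B X; Module.Finite Bᵐᵒᵖ X ∧ Module.Projective Bᵐᵒᵖ X) :
    ∃ (n : ℕ) (x : Fin n → X) (f : Fin n → X →ₗ[k] Bᵐᵒᵖ),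
      (∀ i b v, f i (((1 : A) ⊗ₜ[k] b) • v) = b * f i v) ∧
      ∀ v, ∑ i, ((1 : A) ⊗ₜ[k] f i v) • x i = v := by
  let := rightRestrict k A B X
  obtain ⟨_, _⟩ := h
  obtain ⟨n, x, f, hf⟩ := exists_isDualBasis Bᵐᵒᵖ X
  refine ⟨n, x, fun i => { (f i).toAddMonoidHom with
    map_smul' := fun c v => ?_ }, fun i a v => (f i).map_smul a v, hf⟩
  have hc : c • v = algebraMap k Bᵐᵒᵖ c • v := by
    rw [← algebraMap_smul (A ⊗[k] Bᵐᵒᵖ) c v, Algebra.TensorProduct.algebraMap_apply,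
      Algebra.algebraMap_eq_smul_one, TensorProduct.smul_tmul, ← Algebra.algebraMap_eq_smul_one]
    rfl
  change f i (c • v) = c • f i v
  rw [hc, map_smul, smul_eq_mul, Algebra.smul_def]

end OneSidedDualBasis

section BimodTensor

variable (k : Type) [Field k] (Γ Λ : Type) [Ring Γ] [Ring Λ] [Algebra k Γ] [Algebra k Λ]
variable (N : Type) [AddCommGroup N] [Module k N] [Module (Γ ⊗[k] Λᵐᵒᵖ) N]
variable (M : Type) [AddCommGroup M] [Module k M] [Module (Λ ⊗[k] Γᵐᵒᵖ) M]

/-- The right action of `Λ ⊗ Λᵐᵒᵖ` on `N ⊗[k] M` through the inner factors: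
`(n ⊗ m) · (a ⊗ bᵒᵖ) = n a ⊗ b m`. -/
noncomputable def innerAction [IsScalarTower k (Γ ⊗[k] Λᵐᵒᵖ) N]
    [IsScalarTower k (Λ ⊗[k] Γᵐᵒᵖ) M] :
    (Λ ⊗[k] Λᵐᵒᵖ)ᵐᵒᵖ →ₐ[k] Module.End k (N ⊗[k] M) :=
  (Algebra.TensorProduct.lift
    ((rTensorAlgHom k N M).comp ((Algebra.lsmul k k N).comp
      (Algebra.TensorProduct.includeRight : Λᵐᵒᵖ →ₐ[k] Γ ⊗[k] Λᵐᵒᵖ)))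
    ((lTensorAlgHom k N M).comp ((Algebra.lsmul k k M).comp
      ((Algebra.TensorProduct.includeLeft : Λ →ₐ[k] Λ ⊗[k] Γᵐᵒᵖ).comp
        (AlgEquiv.opOp k Λ).symm.toAlgHom)))
    (fun a c => by
      change Commute (LinearMap.rTensor M _) (LinearMap.lTensor N _)
      unfold Commute SemiconjBy
      ext x y
      simp [LinearMap.rTensor, LinearMap.lTensor, TensorProduct.map_tmul])).comp
  (Algebra.TensorProduct.opAlgEquiv k k Λ Λᵐᵒᵖ).symm.toAlgHom

/-- The tensor product `N ⊗[k] M` over the ground field of a `(Γ, Λ)`-bimodule and a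
`(Λ, Γ)`-bimodule, as a left module over `Γ ⊗ Γᵐᵒᵖ` (acting from outside) and a right module over
`Λ ⊗ Λᵐᵒᵖ` (acting from inside). -/
def BimodTensor (k Γ Λ : Type) [Field k] [Ring Γ] [Ring Λ] [Algebra k Γ] [Algebra k Λ]
    (N : Type) [AddCommGroup N] [Module k N] [Module (Γ ⊗[k] Λᵐᵒᵖ) N]
    (M : Type) [AddCommGroup M] [Module k M] [Module (Λ ⊗[k] Γᵐᵒᵖ) M] : Type := N ⊗[k] M

namespace BimodTensor

noncomputable instance : AddCommGroup (BimodTensor k Γ Λ N M) :=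
  inferInstanceAs (AddCommGroup (N ⊗[k] M))

section Tmul

variable {N M}

/-- The pure tensor `n ⊗ m`. -/
def tmul (n : N) (m : M) : BimodTensor k Γ Λ N M := n ⊗ₜ[k] m

variable {k Γ Λ}

@[elab_as_elim]
theorem induction_on {p : BimodTensor k Γ Λ N M → Prop} (z : BimodTensor k Γ Λ N M)
    (h0 : p 0) (htmul : ∀ n m, p (tmul k Γ Λ n m)) (hadd : ∀ y z, p y → p z → p (y + z)) : p z :=
  TensorProduct.induction_on z h0 htmul hadd

theorem tmul_sum_sum {ι κ : Type} [Fintype ι] [Fintype κ] (n : ι → N) (m : κ → M) :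
    tmul k Γ Λ (∑ i, n i) (∑ j, m j) = ∑ ij : ι × κ, tmul k Γ Λ (n ij.1) (m ij.2) := by
  rw [Fintype.sum_prod_type]
  refine (TensorProduct.sum_tmul _ _ _).trans (Finset.sum_congr rfl fun i _ => ?_)
  exact TensorProduct.tmul_sum _ _ _

end Tmul

variable [IsScalarTower k (Γ ⊗[k] Λᵐᵒᵖ) N] [IsScalarTower k (Λ ⊗[k] Γᵐᵒᵖ) M]

noncomputable instance : Module (Γ ⊗[k] Γᵐᵒᵖ) (BimodTensor k Γ Λ N M) :=
  outerModule k Γ Λ Γ N M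

noncomputable instance : Module (Λ ⊗[k] Λᵐᵒᵖ)ᵐᵒᵖ (BimodTensor k Γ Λ N M) :=
  Module.compHom (N ⊗[k] M) (innerAction k Γ Λ N M).toRingHom

variable {k Γ Λ N M}

theorem outer_smul_tmul (a : Γ) (c : Γᵐᵒᵖ) (n : N) (m : M) :
    (a ⊗ₜ[k] c) • tmul k Γ Λ n m =
      tmul k Γ Λ ((a ⊗ₜ[k] (1 : Λᵐᵒᵖ)) • n) (((1 : Λ) ⊗ₜ[k] c) • m) := by
  change outerAction k Γ Λ Γ N M (a ⊗ₜ[k] c) (n ⊗ₜ[k] m) = _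
  rw [outerAction, Algebra.TensorProduct.lift_tmul]
  rfl

theorem inner_smul_tmul (a : Λ) (b : Λᵐᵒᵖ) (n : N) (m : M) :
    op (a ⊗ₜ[k] b) • tmul k Γ Λ n m =
      tmul k Γ Λ (((1 : Γ) ⊗ₜ[k] op a) • n) ((unop b ⊗ₜ[k] (1 : Γᵐᵒᵖ)) • m) := by
  change innerAction k Γ Λ N M (op (a ⊗ₜ[k] b)) (n ⊗ₜ[k] m) = _
  have h : (Algebra.TensorProduct.opAlgEquiv k k Λ Λᵐᵒᵖ).symm.toAlgHom (op (a ⊗ₜ[k] b)) =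
    op a ⊗ₜ[k] op b := rfl
  rw [innerAction, AlgHom.comp_apply, h, Algebra.TensorProduct.lift_tmul]
  rfl

theorem zero_outer_smul (z : BimodTensor k Γ Λ N M) : (0 : Γ ⊗[k] Γᵐᵒᵖ) • z = 0 :=
  zero_smul (Γ ⊗[k] Γᵐᵒᵖ) z

theorem zero_inner_smul (z : BimodTensor k Γ Λ N M) : op (0 : Λ ⊗[k] Λᵐᵒᵖ) • z = 0 :=
  zero_smul (Λ ⊗[k] Λᵐᵒᵖ)ᵐᵒᵖ z

instance : SMulCommClass (Γ ⊗[k] Γᵐᵒᵖ) (Λ ⊗[k] Λᵐᵒᵖ)ᵐᵒᵖ (BimodTensor k Γ Λ N M) := by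
  constructor
  intro s t z
  induction t with | _ t
  induction z using BimodTensor.induction_on with
  | h0 => simp
  | hadd y z hy hz => simp only [smul_add, hy, hz]
  | htmul n m =>
    induction s with
    | zero => simp only [zero_outer_smul, smul_zero]
    | add y z hy hz => simp only [add_smul, smul_add, hy, hz]
    | tmul a c =>
      induction t with
      | zero => simp only [zero_inner_smul, smul_zero]
      | add y z hy hz => simp only [op_add, add_smul, smul_add, hy, hz]
      | tmul x y =>
        simp only [outer_smul_tmul, inner_smul_tmul, ← mul_smul, Algebra.TensorProduct.tmul_mul_tmul,
          one_mul, mul_one]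

theorem finite_and_projective_outer
    (hN : letI := leftRestrict k Γ Λ N; Module.Finite Γ N ∧ Module.Projective Γ N)
    (hM : letI := rightRestrict k Λ Γ M; Module.Finite Γᵐᵒᵖ M ∧ Module.Projective Γᵐᵒᵖ M) :
    Module.Finite (Γ ⊗[k] Γᵐᵒᵖ) (BimodTensor k Γ Λ N M) ∧
      Module.Projective (Γ ⊗[k] Γᵐᵒᵖ) (BimodTensor k Γ Λ N M) := by
  obtain ⟨r, x, φ, hφ, hx⟩ := exists_left_dualBasis k hN
  obtain ⟨s, y, ψ, hψ, hy⟩ := exists_right_dualBasis k hM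
  let F (ij : Fin r × Fin s) : BimodTensor k Γ Λ N M →ₗ[Γ ⊗[k] Γᵐᵒᵖ] Γ ⊗[k] Γᵐᵒᵖ :=
    { (TensorProduct.map (φ ij.1) (ψ ij.2)).toAddMonoidHom with
      map_smul' := fun t z => by
        change TensorProduct.map (φ ij.1) (ψ ij.2) (t • z) =
          t * TensorProduct.map (φ ij.1) (ψ ij.2) z
        induction z using BimodTensor.induction_on with
        | h0 => rw [smul_zero]; exact ((map_zero _).trans (mul_zero _).symm)
        | hadd y z hy hz => rw [smul_add]; erw [map_add, map_add]; rw [hy, hz, mul_add]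
        | htmul n m =>
          induction t with
          | zero => rw [zero_outer_smul, zero_mul]; exact map_zero _
          | add y z hy hz => rw [add_smul, add_mul, ← hy, ← hz]; exact map_add _ _ _
          | tmul a c =>
            rw [outer_smul_tmul]
            change φ ij.1 _ ⊗ₜ[k] ψ ij.2 _ = (a ⊗ₜ[k] c) * (φ ij.1 n ⊗ₜ[k] ψ ij.2 m)
            rw [hφ, hψ, Algebra.TensorProduct.tmul_mul_tmul] }
  have h : IsDualBasis (fun ij => tmul k Γ Λ (x ij.1) (y ij.2)) F := fun z => by
    induction z using BimodTensor.induction_on with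
    | h0 => exact Finset.sum_eq_zero fun ij _ => by rw [map_zero, zero_outer_smul]
    | hadd y z hy hz => simp only [map_add, add_smul, Finset.sum_add_distrib, hy, hz]
    | htmul n m =>
      conv_rhs => rw [← hx n, ← hy m, tmul_sum_sum]
      refine Finset.sum_congr rfl fun ij _ => ?_
      exact outer_smul_tmul _ _ _ _
  exact ⟨h.finite, h.projective⟩

theorem finite_and_projective_inner
    (hN : letI := rightRestrict k Γ Λ N; Module.Finite Λᵐᵒᵖ N ∧ Module.Projective Λᵐᵒᵖ N)
    (hM : letI := leftRestrict k Λ Γ M; Module.Finite Λ M ∧ Module.Projective Λ M) :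
    Module.Finite (Λ ⊗[k] Λᵐᵒᵖ)ᵐᵒᵖ (BimodTensor k Γ Λ N M) ∧
      Module.Projective (Λ ⊗[k] Λᵐᵒᵖ)ᵐᵒᵖ (BimodTensor k Γ Λ N M) := by
  obtain ⟨r, x, φ, hφ, hx⟩ := exists_right_dualBasis k hN
  obtain ⟨s, y, ψ, hψ, hy⟩ := exists_left_dualBasis k hM
  let G (ij : Fin r × Fin s) : N ⊗[k] M →ₗ[k] (Λ ⊗[k] Λᵐᵒᵖ)ᵐᵒᵖ :=
    (opLinearEquiv k).toLinearMap ∘ₗ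
      TensorProduct.map ((opLinearEquiv k).symm.toLinearMap ∘ₗ φ ij.1)
        ((opLinearEquiv k).toLinearMap ∘ₗ ψ ij.2)
  let F (ij : Fin r × Fin s) :
      BimodTensor k Γ Λ N M →ₗ[(Λ ⊗[k] Λᵐᵒᵖ)ᵐᵒᵖ] (Λ ⊗[k] Λᵐᵒᵖ)ᵐᵒᵖ :=
    { (G ij).toAddMonoidHom with
      map_smul' := fun t z => by
        change G ij (t • z) = t * G ij z
        induction t with | _ t
        induction z using BimodTensor.induction_on with
        | h0 => rw [smul_zero]; exact ((map_zero _).trans (mul_zero _).symm)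
        | hadd y z hy hz => rw [smul_add]; erw [map_add, map_add]; rw [hy, hz, mul_add]
        | htmul n m =>
          induction t with
          | zero => rw [zero_inner_smul, op_zero, zero_mul]; exact map_zero _
          | add y z hy hz => rw [op_add, add_smul, add_mul, ← hy, ← hz]; exact map_add _ _ _
          | tmul a c =>
            rw [inner_smul_tmul]
            change op (unop (φ ij.1 _) ⊗ₜ[k] op (ψ ij.2 _)) =
              op ((unop (φ ij.1 n) ⊗ₜ[k] op (ψ ij.2 m)) * (a ⊗ₜ[k] c))
            rw [hφ, hψ, Algebra.TensorProduct.tmul_mul_tmul]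
            rfl }
  have h : IsDualBasis (fun ij => tmul k Γ Λ (x ij.1) (y ij.2)) F := fun z => by
    induction z using BimodTensor.induction_on with
    | h0 => exact Finset.sum_eq_zero fun ij _ => by rw [map_zero]; exact zero_inner_smul _
    | hadd y z hy hz => simp only [map_add, add_smul, Finset.sum_add_distrib, hy, hz]
    | htmul n m =>
      conv_rhs => rw [← hx n, ← hy m, tmul_sum_sum]
      refine Finset.sum_congr rfl fun ij _ => ?_
      exact inner_smul_tmul _ _ _ _
  exact ⟨h.finite, h.projective⟩

end BimodTensor

end BimodTensor

section RegularBimodule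

variable (k Λ : Type) [Field k] [Ring Λ] [Algebra k Λ]

theorem regularBimodule_tmul_smul (a : Λ) (b : Λᵐᵒᵖ) (x : Λ) :
    letI := regularBimodule k Λ
    (a ⊗ₜ[k] b) • x = a * x * unop b := by
  let := regularBimodule k Λ
  refine (TensorProduct.Algebra.smul_def a b x).trans ?_
  exact (mul_assoc a x (unop b)).symm

theorem finite_regularBimodule :
    letI := regularBimodule k Λ
    Module.Finite (Λ ⊗[k] Λᵐᵒᵖ) Λ := by
  let := regularBimodule k Λ
  refine .of_surjective (LinearMap.toSpanSingleton (Λ ⊗[k] Λᵐᵒᵖ) Λ 1) fun x => ⟨x ⊗ₜ[k] 1, ?_⟩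
  exact (regularBimodule_tmul_smul k Λ x 1 1).trans (by simp)

end RegularBimodule

namespace BimodTensor

variable (k Γ Λ : Type) [Field k] [Ring Γ] [Ring Λ] [Algebra k Γ] [Algebra k Λ]
variable (N : Type) [AddCommGroup N] [Module k N] [Module (Γ ⊗[k] Λᵐᵒᵖ) N]
  [IsScalarTower k (Γ ⊗[k] Λᵐᵒᵖ) N]
variable (M : Type) [AddCommGroup M] [Module k M] [Module (Λ ⊗[k] Γᵐᵒᵖ) M]
  [IsScalarTower k (Λ ⊗[k] Γᵐᵒᵖ) M]

/-- The projection from `N ⊗[k] M` to the balanced tensor product `N ⊗_Λ M`. -/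
noncomputable def toBTensor : BimodTensor k Γ Λ N M →ₗ[Γ ⊗[k] Γᵐᵒᵖ] BTensor k Γ Λ Γ N M :=
  letI := outerModule k Γ Λ Γ N M
  (balancedSub k Γ Λ Γ N M).mkQ

/-- The linear map on `N ⊗_Λ M` induced by a balanced linear map on `N ⊗[k] M`. -/
noncomputable def liftBTensor {Y : Type} [AddCommGroup Y] [Module (Γ ⊗[k] Γᵐᵒᵖ) Y]
    (f : BimodTensor k Γ Λ N M →ₗ[Γ ⊗[k] Γᵐᵒᵖ] Y)
    (hf : ∀ (n : N) (b : Λ) (m : M), f (tmul k Γ Λ (((1 : Γ) ⊗ₜ[k] op b) • n) m) =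
      f (tmul k Γ Λ n ((b ⊗ₜ[k] (1 : Γᵐᵒᵖ)) • m))) :
    BTensor k Γ Λ Γ N M →ₗ[Γ ⊗[k] Γᵐᵒᵖ] Y :=
  letI := outerModule k Γ Λ Γ N M
  (balancedSub k Γ Λ Γ N M).liftQ f <| Submodule.span_le.2 <| by
    rintro _ ⟨n, b, m, rfl⟩
    exact (map_sub f _ _).trans (sub_eq_zero.2 (hf n b m))

variable {k Γ Λ N M}

theorem toBTensor_surjective : Function.Surjective (toBTensor k Γ Λ N M) :=
  letI := outerModule k Γ Λ Γ N M
  (balancedSub k Γ Λ Γ N M).mkQ_surjective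

theorem toBTensor_balanced (n : N) (b : Λ) (m : M) :
    toBTensor k Γ Λ N M (tmul k Γ Λ (((1 : Γ) ⊗ₜ[k] op b) • n) m) =
      toBTensor k Γ Λ N M (tmul k Γ Λ n ((b ⊗ₜ[k] (1 : Γᵐᵒᵖ)) • m)) :=
  letI := outerModule k Γ Λ Γ N M
  (Submodule.Quotient.eq (balancedSub k Γ Λ Γ N M)).2 (Submodule.subset_span ⟨n, b, m, rfl⟩)

theorem toBTensor_inner_smul (a : Λ) (b : Λᵐᵒᵖ) (u : BimodTensor k Γ Λ N M) :
    toBTensor k Γ Λ N M (op (a ⊗ₜ[k] b) • u) =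
      toBTensor k Γ Λ N M (op ((a * unop b) ⊗ₜ[k] (1 : Λᵐᵒᵖ)) • u) := by
  induction u using BimodTensor.induction_on with
  | h0 => simp only [smul_zero]
  | hadd y z hy hz => simp only [smul_add, map_add, hy, hz]
  | htmul n m =>
    rw [inner_smul_tmul, inner_smul_tmul, ← toBTensor_balanced, ← mul_smul,
      Algebra.TensorProduct.tmul_mul_tmul, ← op_mul, unop_one, ← Algebra.TensorProduct.one_def,
      one_smul, mul_one]

theorem toBTensor_smul_inner_smul (s : Λ ⊗[k] Λᵐᵒᵖ) (x : Λ) (u : BimodTensor k Γ Λ N M) :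
    letI := regularBimodule k Λ
    toBTensor k Γ Λ N M (op (x ⊗ₜ[k] (1 : Λᵐᵒᵖ)) • op s • u) =
      toBTensor k Γ Λ N M (op ((s • x) ⊗ₜ[k] (1 : Λᵐᵒᵖ)) • u) := by
  let := regularBimodule k Λ
  rw [← mul_smul, ← op_mul]
  induction s with
  | zero =>
    rw [zero_mul, zero_smul (Λ ⊗[k] Λᵐᵒᵖ) x, TensorProduct.zero_tmul]
  | add s t hs ht =>
    rw [add_mul, op_add, add_smul, map_add, hs, ht, add_smul, TensorProduct.add_tmul, op_add,
      add_smul, map_add]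
  | tmul a b =>
    rw [Algebra.TensorProduct.tmul_mul_tmul, mul_one, toBTensor_inner_smul,
      regularBimodule_tmul_smul]

/-- The canonical isomorphism `(N ⊗[k] M) ⊗_{Λᵉ} Λ ≅ N ⊗_Λ M`. -/
theorem nonempty_rTensor_equiv :
    letI := regularBimodule k Λ
    Nonempty (RTensor (Λ ⊗[k] Λᵐᵒᵖ) (Γ ⊗[k] Γᵐᵒᵖ) (BimodTensor k Γ Λ N M) Λ ≃ₗ[Γ ⊗[k] Γᵐᵒᵖ]
      BTensor k Γ Λ Γ N M) := by
  let := regularBimodule k Λ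
  let F : RTensor (Λ ⊗[k] Λᵐᵒᵖ) (Γ ⊗[k] Γᵐᵒᵖ) (BimodTensor k Γ Λ N M) Λ →ₗ[Γ ⊗[k] Γᵐᵒᵖ]
      BTensor k Γ Λ Γ N M :=
    RTensor.lift
      (AddMonoidHom.mk' (fun u => AddMonoidHom.mk'
          (fun x => toBTensor k Γ Λ N M (op (x ⊗ₜ[k] (1 : Λᵐᵒᵖ)) • u))
          fun x y => by rw [TensorProduct.add_tmul, op_add, add_smul, map_add])
        fun u v => by ext x; simp only [AddMonoidHom.mk'_apply, smul_add, map_add,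
          AddMonoidHom.add_apply])
      (fun u s x => toBTensor_smul_inner_smul s x u)
      (fun b u x => by simp only [AddMonoidHom.mk'_apply, ← smul_comm b, map_smul])
  have hone (b : Λ) : (b ⊗ₜ[k] (1 : Λᵐᵒᵖ)) • (1 : Λ) = ((1 : Λ) ⊗ₜ[k] op b) • (1 : Λ) := by
    rw [regularBimodule_tmul_smul, regularBimodule_tmul_smul]
    simp
  let G : BTensor k Γ Λ Γ N M →ₗ[Γ ⊗[k] Γᵐᵒᵖ]
      RTensor (Λ ⊗[k] Λᵐᵒᵖ) (Γ ⊗[k] Γᵐᵒᵖ) (BimodTensor k Γ Λ N M) Λ :=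
    liftBTensor k Γ Λ N M
      { toFun := fun u => RTensor.mk _ _ u 1
        map_add' := fun u v => RTensor.mk_add_left u v 1
        map_smul' := fun b u => rfl }
      fun n b m => by
        have h := RTensor.mk_op_smul (A := Λ ⊗[k] Λᵐᵒᵖ) (B := Γ ⊗[k] Γᵐᵒᵖ) (tmul k Γ Λ n m)
          (b ⊗ₜ[k] (1 : Λᵐᵒᵖ)) (1 : Λ)
        rw [hone, ← RTensor.mk_op_smul, inner_smul_tmul, inner_smul_tmul] at h
        simp only [unop_one, unop_op, op_one, ← Algebra.TensorProduct.one_def, one_smul] at h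
        exact h
  refine ⟨LinearEquiv.ofLinearMap F G (LinearMap.ext fun z => ?_) (LinearMap.ext fun z => ?_)⟩
  · obtain ⟨u, rfl⟩ := toBTensor_surjective z
    change toBTensor k Γ Λ N M (op ((1 : Λ) ⊗ₜ[k] (1 : Λᵐᵒᵖ)) • u) = _
    rw [← Algebra.TensorProduct.one_def, op_one, one_smul]
    rfl
  · refine RTensor.induction_on z (by simp) (fun u x => ?_) fun y z hy hz => ?_
    · change RTensor.mk _ _ (op (x ⊗ₜ[k] (1 : Λᵐᵒᵖ)) • u) (1 : Λ) = RTensor.mk _ _ u x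
      rw [RTensor.mk_op_smul, regularBimodule_tmul_smul]
      simp
    · rw [map_add, hy, hz, map_add]

end BimodTensor

section SingularEquivalence

variable {k Λ Γ : Type} [Field k] [Ring Λ] [Ring Γ] [Algebra k Λ] [Algebra k Γ]
variable {M : Type} [AddCommGroup M] [Module k M] [Module (Λ ⊗[k] Γᵐᵒᵖ) M]
  [IsScalarTower k (Λ ⊗[k] Γᵐᵒᵖ) M]
variable {N : Type} [AddCommGroup N] [Module k N] [Module (Γ ⊗[k] Λᵐᵒᵖ) N]
  [IsScalarTower k (Γ ⊗[k] Λᵐᵒᵖ) N] {l : ℕ}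

theorem DefinesSingEqOfLevel.symm (h : DefinesSingEqOfLevel k Λ Γ M N l) :
    DefinesSingEqOfLevel k Γ Λ N M l :=
  ⟨h.2.2.1, h.2.2.2.1, h.1, h.2.1, h.2.2.2.2.2, h.2.2.2.2.1⟩

theorem DefinesSingEqOfLevel.syzygyTransfer (h : DefinesSingEqOfLevel k Λ Γ M N l) :
    letI := regularBimodule k Λ
    letI := regularBimodule k Γ
    SyzygyTransfer (Λ ⊗[k] Λᵐᵒᵖ) (Γ ⊗[k] Γᵐᵒᵖ) (ModuleCat.of _ Λ) (ModuleCat.of _ Γ) (l + 1) := by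
  let := regularBimodule k Λ
  let := regularBimodule k Γ
  obtain ⟨hΛM, hMΓ, hΓN, hNΛ, -, Z, hZ, hst⟩ := h
  obtain ⟨_, _⟩ := BimodTensor.finite_and_projective_outer (N := N) (M := M) hΓN hMΓ
  obtain ⟨_, _⟩ := BimodTensor.finite_and_projective_inner (N := N) (M := M) hNΛ hΛM
  obtain ⟨e⟩ := BimodTensor.nonempty_rTensor_equiv (k := k) (Γ := Γ) (Λ := Λ) (N := N) (M := M)
  exact SyzygyTransfer.of_stablyIso_rTensor (BimodTensor k Γ Λ N M)
    (X := ModuleCat.of (Λ ⊗[k] Λᵐᵒᵖ) Λ) hZ ((StablyIso.of_equiv e).trans hst)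

variable (k Λ) in
theorem exists_isNthSyzygyOf_regularBimodule [FiniteDimensional k Λ] :
    letI := regularBimodule k Λ
    ∃ ω : ℕ → ModuleCat.{0} (Λ ⊗[k] Λᵐᵒᵖ),
      ∀ i, IsNthSyzygyOf (Λ ⊗[k] Λᵐᵒᵖ) i (ω i) (ModuleCat.of _ Λ) := by
  let := regularBimodule k Λ
  have := finite_regularBimodule k Λ
  have : Module.Finite k Λᵐᵒᵖ := Module.Finite.equiv (opLinearEquiv k)
  have : IsArtinianRing (Λ ⊗[k] Λᵐᵒᵖ) := IsArtinianRing.of_finite k _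
  choose ω _ hω using fun i => IsNthSyzygyOf.exists_of_finite i (ModuleCat.of (Λ ⊗[k] Λᵐᵒᵖ) Λ)
  exact ⟨ω, hω⟩

end SingularEquivalence

theorem statement_7 (k Λ Γ : Type) [Field k] [Ring Λ] [Ring Γ]
    [Algebra k Λ] [Algebra k Γ] [FiniteDimensional k Λ] [FiniteDimensional k Γ]
    (hsing : Nonempty (SingEqMoritaLevel k Λ Γ))
    (hΛ : IsEventuallyPeriodicAlgebra k Λ) :
    IsEventuallyPeriodicAlgebra k Γ ∧
    (letI := regularBimodule k Λ; letI := regularBimodule k Γ;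
      ∀ (n m p q : ℕ) (Z : ModuleCat.{0} (Λ ⊗[k] Λᵐᵒᵖ)) (W : ModuleCat.{0} (Γ ⊗[k] Γᵐᵒᵖ)),
        IsNthSyzygyOf (Λ ⊗[k] Λᵐᵒᵖ) n Z (ModuleCat.of (Λ ⊗[k] Λᵐᵒᵖ) Λ) → Nontrivial Z →
        IsPeriodicWithPeriod (Λ ⊗[k] Λᵐᵒᵖ) Z p →
        IsNthSyzygyOf (Γ ⊗[k] Γᵐᵒᵖ) m W (ModuleCat.of (Γ ⊗[k] Γᵐᵒᵖ) Γ) → Nontrivial W →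
        IsPeriodicWithPeriod (Γ ⊗[k] Γᵐᵒᵖ) W q →
        p = q) := by
  obtain ⟨⟨M, N, l, h⟩⟩ := hsing
  obtain ⟨ω, hω⟩ := exists_isNthSyzygyOf_regularBimodule k Λ
  obtain ⟨ω', hω'⟩ := exists_isNthSyzygyOf_regularBimodule k Γ
  have hT := h.syzygyTransfer
  have hT' := h.symm.syzygyTransfer
  refine ⟨hT.isEventuallyPeriodicModule hT' hω hω' hΛ, ?_⟩
  intro n m p q Z W hZ _ hZp hW _ hWq
  exact le_antisymm (hT'.period_le hω' hω hW hWq hZ hZp) (hT.period_le hω hω' hZ hZp hW hWq)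
end

section
/- Let k be a field and let Λ and Γ be finite dimensional self-injective k-algebras. Then Λ and Γ are singularly equivalent of Morita type with level (i.e. with some level l ≥ 0) if and only if Λ and Γ are singularly equivalent of Morita type with level 0, that is, stably equivalent of Morita type. -/
open TensorProduct MulOpposite

section Kasch

/-- Over a finite dimensional left self-injective algebra, a proper two-sided ideal has a nonzero
left annihilator. -/
theorem exists_ne_zero_forall_mul_eq_zero (k : Type) {A : Type} [Field k] [Ring A] [Algebra k A]
    [FiniteDimensional k A] (hA : Module.Injective A A) (I : Ideal A) [I.IsTwoSided]
    (hI : I ≠ ⊤) : ∃ a : A, a ≠ 0 ∧ ∀ x ∈ I, a * x = 0 := by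
  classical
  by_contra! H
  obtain ⟨s, hs⟩ := (IsNoetherian.noetherian (I.restrictScalars k) : (I.restrictScalars k).FG)
  have hsI : ∀ x ∈ s, x ∈ I := fun x hx => by
    have : x ∈ I.restrictScalars k := hs ▸ Submodule.subset_span hx
    simpa using this
  let f : A →ₗ[A] (s → A) := LinearMap.pi fun x => LinearMap.toSpanSingleton A A (x : A)
  have hf : Function.Injective f := by
    rw [injective_iff_map_eq_zero]
    intro a ha
    by_contra hne
    obtain ⟨x, hxI, hx⟩ := H a hne
    apply hx
    have hx' : x ∈ Submodule.span k (s : Set A) := by rw [hs]; simpa using hxI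
    clear hx hxI
    induction hx' using Submodule.span_induction with
    | mem x hx => simpa [f] using congrFun ha ⟨x, hx⟩
    | zero => simp
    | add x y _ _ hx hy => rw [mul_add, hx, hy, add_zero]
    | smul c x _ hx => rw [mul_smul_comm, hx, smul_zero]
  obtain ⟨h, hh⟩ := Module.Injective.out f hf LinearMap.id
  apply hI
  rw [Ideal.eq_top_iff_one, ← LinearMap.id_apply (R := A) (1 : A), ← hh 1]
  have h1 : f 1 = ∑ x : s, (x : A) • (Pi.single x (1 : A) : s → A) := by
    rw [← Finset.univ_sum_single (f 1)]
    refine Finset.sum_congr rfl fun x _ => ?_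
    ext y
    by_cases hxy : y = x
    · subst hxy; simp [f]
    · simp [hxy]
  rw [h1, map_sum]
  refine Ideal.sum_mem _ fun x _ => ?_
  rw [map_smul, smul_eq_mul]
  exact Ideal.mul_mem_right _ _ (hsI x x.2)

variable {A : Type} [Ring A]

/-- Every simple module over an Artinian ring embeds in the ring modulo its radical. -/
theorem IsSimpleModule.exists_injective_quotient_jacobson [IsArtinianRing A] (S : Type)
    [AddCommGroup S] [Module A S] [IsSimpleModule A S] :
    ∃ f : S →ₗ[A] (A ⧸ Ring.jacobson A), Function.Injective f := by
  have hss : IsSemisimpleModule A (A ⧸ Ring.jacobson A) :=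
    (IsArtinian.isSemisimpleModule_iff_jacobson A _).2 (Module.jacobson_quotient_jacobson A A)
  obtain ⟨m, hm, ⟨e⟩⟩ := isSimpleModule_iff_quot_maximal.1 ‹IsSimpleModule A S›
  let p : (A ⧸ Ring.jacobson A) →ₗ[A] S :=
    e.symm.toLinearMap ∘ₗ Submodule.mapQ _ m LinearMap.id (Ring.jacobson_le_of_isMaximal m)
  have hp : Function.Surjective p := by
    refine e.symm.surjective.comp fun y => ?_
    obtain ⟨a, rfl⟩ := Submodule.mkQ_surjective _ y
    exact ⟨Submodule.Quotient.mk a, rfl⟩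
  obtain ⟨g, hg⟩ := IsSemisimpleModule.lifting_property p hp LinearMap.id
  exact ⟨g, Function.LeftInverse.injective (g := p) fun x => LinearMap.congr_fun hg x⟩

/-- The annihilators of distinct isotypic components of the ring modulo its radical are
comaximal. -/
theorem annihilator_sup_annihilator_isotypicComponents [IsArtinianRing A]
    {c d : Submodule A (A ⧸ Ring.jacobson A)}
    (hc : c ∈ isotypicComponents A (A ⧸ Ring.jacobson A))
    (hd : d ∈ isotypicComponents A (A ⧸ Ring.jacobson A)) (hcd : c ≠ d) :
    Module.annihilator A c ⊔ Module.annihilator A d = ⊤ := by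
  set V := A ⧸ Ring.jacobson A
  have hss : IsSemisimpleModule A V :=
    (IsArtinian.isSemisimpleModule_iff_jacobson A _).2 (Module.jacobson_quotient_jacobson A A)
  let rmul (r : A) : V →ₗ[A] V := Submodule.mapQ _ _ (LinearMap.toSpanSingleton A A r)
    fun x hx => by
      simpa using Ideal.mul_mem_right r (Ring.jacobson A) hx
  have hrmul (r a : A) : rmul r (Submodule.Quotient.mk a) = a • (Submodule.Quotient.mk r : V) := rfl
  set D := sSup (isotypicComponents A V \ {c})
  have hdisj : Disjoint c D := sSupIndep_isotypicComponents A V hc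
  have hdD : d ≤ D := le_sSup ⟨hd, fun h => hcd h.symm⟩
  have hDinv (r : A) : D ≤ D.comap (rmul r) :=
    sSup_le fun e he => (Submodule.IsFullyInvariant.of_mem_isotypicComponents he.1 (rmul r)).trans
      (Submodule.comap_mono (le_sSup he))
  have hcinv (r : A) : c ≤ c.comap (rmul r) :=
    Submodule.IsFullyInvariant.of_mem_isotypicComponents hc (rmul r)
  have htop : c ⊔ D = ⊤ := by
    rw [eq_top_iff, ← sSup_isotypicComponents A V]
    refine sSup_le fun e he => ?_
    by_cases hec : e = c
    · exact hec ▸ le_sup_left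
    · exact le_sup_of_le_right (le_sSup ⟨he, hec⟩)
  obtain ⟨x, hx, y, hy, hxy⟩ := Submodule.mem_sup.1
    (htop ▸ Submodule.mem_top : (Submodule.Quotient.mk 1 : V) ∈ c ⊔ D)
  obtain ⟨a, rfl⟩ := Submodule.mkQ_surjective _ x
  obtain ⟨b, rfl⟩ := Submodule.mkQ_surjective _ y
  have hab : (a + b - 1 : A) ∈ Ring.jacobson A := by
    rw [← Submodule.Quotient.mk_eq_zero]
    simpa [sub_eq_zero] using hxy
  have had : a ∈ Module.annihilator A d := by
    rw [Module.mem_annihilator]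
    rintro ⟨v, hv⟩
    obtain ⟨r, rfl⟩ := Submodule.mkQ_surjective _ v
    refine Subtype.ext ((Submodule.disjoint_def.1 hdisj) _ (hcinv r hx) ?_)
    exact hdD (d.smul_mem a hv)
  have hbc : b ∈ Module.annihilator A c := by
    rw [Module.mem_annihilator]
    rintro ⟨v, hv⟩
    obtain ⟨r, rfl⟩ := Submodule.mkQ_surjective _ v
    exact Subtype.ext ((Submodule.disjoint_def.1 hdisj) _ (c.smul_mem b hv) (hDinv r hy))
  have hJc : Ring.jacobson A ≤ Module.annihilator A c := by
    intro j hj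
    rw [Module.mem_annihilator]
    rintro ⟨v, hv⟩
    obtain ⟨r, rfl⟩ := Submodule.mkQ_surjective _ v
    exact Subtype.ext ((Submodule.Quotient.mk_eq_zero _).2 (Ideal.mul_mem_right r _ hj))
  rw [Ideal.eq_top_iff_one]
  have : (1 : A) = (b - (a + b - 1)) + a := by abel
  rw [this]
  exact Submodule.add_mem_sup (sub_mem hbc (hJc hab)) had

/-- Over a finite dimensional left self-injective algebra, every simple left module embeds in the
regular module. -/
theorem IsSimpleModule.exists_injective_self (k : Type) [Field k] [Algebra k A]
    [FiniteDimensional k A] (hA : Module.Injective A A) (S : Type) [AddCommGroup S] [Module A S]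
    [IsSimpleModule A S] : ∃ f : S →ₗ[A] A, Function.Injective f := by
  have : IsArtinianRing A := IsArtinianRing.of_finite k A
  set V := A ⧸ Ring.jacobson A
  let L (c : isotypicComponents A V) : Submodule A A :=
    { carrier := {a | ∀ x ∈ Module.annihilator A c, a * x = 0}
      add_mem' := fun {a b} ha hb x hx => by rw [add_mul, ha x hx, hb x hx, add_zero]
      zero_mem' := fun x _ => zero_mul x
      smul_mem' := fun r a ha x hx => by rw [smul_eq_mul, mul_assoc, ha x hx, mul_zero] }
  have hL (c) : L c ≠ ⊥ := by
    have hne : Module.annihilator A c ≠ ⊤ := by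
      rw [Ne, Ideal.eq_top_iff_one, Module.mem_annihilator]
      intro h
      obtain ⟨x, hx⟩ := exists_ne (0 : c.1)
      exact hx (by simpa using h x)
    obtain ⟨a, ha, ha'⟩ := exists_ne_zero_forall_mul_eq_zero k hA (Module.annihilator A c) hne
    exact fun h => ha ((Submodule.mem_bot A).1 (h ▸ (ha' : a ∈ L c)))
  choose T hT hTL using fun c => (eq_bot_or_exists_atom_le (L c)).resolve_left (hL c)
  have hTs (c) : IsSimpleModule A (T c) := isSimpleModule_iff_isAtom.2 (hT c)
  choose j hj using fun c => IsSimpleModule.exists_injective_quotient_jacobson (A := A) (T c)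
  have hjs (c) : IsSimpleModule A (LinearMap.range (j c)) :=
    .congr (LinearEquiv.ofInjective (j c) (hj c)).symm
  let σ (c : isotypicComponents A V) : isotypicComponents A V :=
    ⟨isotypicComponent A V (LinearMap.range (j c)), LinearMap.range (j c), hjs c, rfl⟩
  have hσ : Function.Injective σ := by
    intro c d hcd
    by_contra hne
    have hle : LinearMap.range (j d) ≤ isotypicComponent A V (LinearMap.range (j c)) := by
      have := congrArg Subtype.val hcd
      simp only [σ] at this
      rw [this]
      exact Submodule.le_isotypicComponent _
    obtain ⟨e⟩ := isIsotypicOfType_submodule_iff.mp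
      (.isotypicComponent A V (LinearMap.range (j c))) _ hle
    let u : T c ≃ₗ[A] T d := (LinearEquiv.ofInjective (j c) (hj c)).trans
      (e.symm.trans (LinearEquiv.ofInjective (j d) (hj d)).symm)
    obtain ⟨h, hh⟩ := Module.Injective.out (T c).subtype (T c).injective_subtype
      ((T d).subtype ∘ₗ u.toLinearMap)
    have hmul (x : A) : h x = x * h 1 := by
      rw [← smul_eq_mul, ← map_smul, smul_eq_mul, mul_one]
    have := IsSimpleModule.nontrivial A (T c)
    obtain ⟨t, ht⟩ := exists_ne (0 : T c)
    have htd : (u t : A) ∈ L d := hTL d (u t).2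
    have htc : (u t : A) ∈ L c := by
      intro x hx
      have h1 : (u t : A) = t * h 1 := by rw [← hmul]; exact (hh t).symm
      rw [h1, mul_assoc]
      exact hTL c t.2 _ (Ideal.mul_mem_left _ _ hx)
    have htop := annihilator_sup_annihilator_isotypicComponents c.2 d.2
      (fun h => hne (Subtype.ext h))
    obtain ⟨x, hx, y, hy, hxy⟩ := Submodule.mem_sup.1
      (htop ▸ Submodule.mem_top : (1 : A) ∈ _)
    apply ht
    apply u.injective
    rw [map_zero]
    apply Subtype.ext
    have : (u t : A) * (x + y) = 0 := by rw [mul_add, htc x hx, htd y hy, add_zero]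
    simpa [hxy] using this
  have hσs := Finite.surjective_of_injective hσ
  obtain ⟨f, hf⟩ := IsSimpleModule.exists_injective_quotient_jacobson (A := A) S
  have hfs : IsSimpleModule A (LinearMap.range f) :=
    .congr (LinearEquiv.ofInjective f hf).symm
  obtain ⟨c, hc⟩ := hσs ⟨isotypicComponent A V (LinearMap.range f), LinearMap.range f, hfs, rfl⟩
  have hle : LinearMap.range f ≤ isotypicComponent A V (LinearMap.range (j c)) := by
    have := congrArg Subtype.val hc
    simp only [σ] at this
    rw [this]
    exact Submodule.le_isotypicComponent _
  obtain ⟨e⟩ := isIsotypicOfType_submodule_iff.mp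
    (.isotypicComponent A V (LinearMap.range (j c))) _ hle
  let u : S ≃ₗ[A] T c := (LinearEquiv.ofInjective f hf).trans
    (e.trans (LinearEquiv.ofInjective (j c) (hj c)).symm)
  exact ⟨(T c).subtype ∘ₗ u.toLinearMap, (T c).injective_subtype.comp u.injective⟩

/-- A finitely generated module over an Artinian ring whose points are separated by linear forms
embeds in a free module of finite rank. -/
theorem exists_injective_pi_of_separating [IsArtinianRing A] {M : Type} [AddCommGroup M]
    [Module A M] [Module.Finite A M] (hM : ∀ m : M, (∀ g : M →ₗ[A] A, g m = 0) → m = 0) :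
    ∃ (n : ℕ) (f : M →ₗ[A] (Fin n → A)), Function.Injective f := by
  obtain ⟨s, hs⟩ := Finset.exists_inf_le (fun f : M →ₗ[A] A => LinearMap.ker f)
  refine ⟨s.card, LinearMap.pi fun i => (s.equivFin.symm i : M →ₗ[A] A), ?_⟩
  rw [injective_iff_map_eq_zero]
  refine fun m hm => hM m fun g => hs g ?_
  rw [Submodule.mem_finsetInf]
  intro f hf
  simpa using congrFun hm (s.equivFin ⟨f, hf⟩)

/-- Over a finite dimensional left self-injective algebra, every finitely generated left module
embeds in a free module of finite rank. -/
theorem exists_injective_pi_self (k : Type) [Field k] [Algebra k A]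
    [FiniteDimensional k A] (hA : Module.Injective A A) (M : Type) [AddCommGroup M] [Module A M]
    [Module.Finite A M] : ∃ (n : ℕ) (f : M →ₗ[A] (Fin n → A)), Function.Injective f := by
  have : IsArtinianRing A := IsArtinianRing.of_finite k A
  refine exists_injective_pi_of_separating fun m hall => ?_
  by_contra hne
  have : Nontrivial (A ∙ m) :=
    Submodule.nontrivial_iff_ne_bot.2 (by simpa using hne)
  obtain ⟨N, hN, -⟩ := (eq_top_or_exists_le_coatom (⊥ : Submodule A (A ∙ m))).resolve_left
    bot_ne_top
  have : IsSimpleModule A ((A ∙ m) ⧸ N) := isSimpleModule_iff_isCoatom.2 hN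
  obtain ⟨f, hf⟩ := IsSimpleModule.exists_injective_self k hA ((A ∙ m) ⧸ N)
  obtain ⟨h, hh⟩ := Module.Injective.out (A ∙ m).subtype (A ∙ m).injective_subtype (f ∘ₗ N.mkQ)
  have h0 := hh ⟨m, Submodule.mem_span_singleton_self m⟩
  rw [Submodule.subtype_apply, hall h] at h0
  have h1 : (⟨m, Submodule.mem_span_singleton_self m⟩ : (A ∙ m)) ∈ N := by
    rw [← Submodule.Quotient.mk_eq_zero]
    exact hf (by rw [map_zero]; exact h0.symm)
  apply hN.1
  rw [eq_top_iff]
  rintro ⟨x, hx⟩ -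
  obtain ⟨r, rfl⟩ := Submodule.mem_span_singleton.1 hx
  exact N.smul_mem r h1

end Kasch

section Casimir

variable (k : Type) [Field k] (A B : Type) [Ring A] [Algebra k A] [Ring B] [Algebra k B]

/-- The `k`-dual of a `k`-algebra `A`, as a left `A`-module via `(a • φ) x = φ (x * a)`. -/
def CoDual : Type := Module.Dual k A

namespace CoDual

noncomputable instance : AddCommGroup (CoDual k A) :=
  inferInstanceAs (AddCommGroup (Module.Dual k A))

noncomputable instance : Module k (CoDual k A) := inferInstanceAs (Module k (Module.Dual k A))

/-- The identification of `CoDual k A` with the `k`-dual of `A`. -/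
noncomputable def toDual : CoDual k A ≃ₗ[k] (A →ₗ[k] k) := LinearEquiv.refl k (Module.Dual k A)

variable {k A}

@[ext] theorem ext {φ ψ : CoDual k A} (h : ∀ x, toDual k A φ x = toDual k A ψ x) : φ = ψ :=
  (toDual k A).injective (LinearMap.ext h)

noncomputable instance : SMul A (CoDual k A) where
  smul a φ := (toDual k A).symm (toDual k A φ ∘ₗ LinearMap.mulRight k a)

@[simp] theorem toDual_smul (a : A) (φ : CoDual k A) (x : A) :
    toDual k A (a • φ) x = toDual k A φ (x * a) := rfl

noncomputable instance : Module A (CoDual k A) where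
  one_smul φ := by ext; simp
  mul_smul a b φ := by ext; simp [mul_assoc]
  smul_zero a := by ext; simp
  smul_add a φ ψ := by ext; simp
  add_smul a b φ := by ext; simp [mul_add]
  zero_smul φ := by ext; simp

instance : IsScalarTower k A (CoDual k A) where
  smul_assoc c a φ := by ext; simp

instance [FiniteDimensional k A] : Module.Finite A (CoDual k A) :=
  have : Module.Finite k (CoDual k A) := Module.Finite.equiv (toDual k A).symm
  Module.Finite.of_restrictScalars_finite k A _

/-- The `A`-linear map into `CoDual k A` associated with a `k`-linear functional. -/
noncomputable def coextend {X : Type} [AddCommGroup X] [Module k X] [Module A X]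
    [IsScalarTower k A X] (h : X →ₗ[k] k) : X →ₗ[A] CoDual k A where
  toFun x := (toDual k A).symm (h ∘ₗ (LinearMap.toSpanSingleton A X x).restrictScalars k)
  map_add' x y := by ext; simp
  map_smul' b x := by ext; simp [mul_smul]

@[simp] theorem toDual_coextend {X : Type} [AddCommGroup X] [Module k X] [Module A X]
    [IsScalarTower k A X] (h : X →ₗ[k] k) (x : X) (a : A) :
    toDual k A (coextend (A := A) h x) a = h (a • x) := by
  simp [coextend]

variable (k A) in
/-- Evaluation at `1`. -/
noncomputable def evalOne : CoDual k A →ₗ[k] k :=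
  LinearMap.applyₗ 1 ∘ₗ (toDual k A).toLinearMap

@[simp] theorem evalOne_apply (φ : CoDual k A) : evalOne k A φ = toDual k A φ 1 := rfl

variable (k A) in
theorem injective : Module.Injective A (CoDual k A) where
  out X Y _ _ _ _ f hf g := by
    let := modK k A X
    let := modK k A Y
    have := towerK k A X
    have := towerK k A Y
    obtain ⟨r, hr⟩ := (f.restrictScalars k).exists_leftInverse_of_injective
      (LinearMap.ker_eq_bot.2 hf)
    refine ⟨coextend (evalOne k A ∘ₗ g.restrictScalars k ∘ₗ r), fun x => ?_⟩
    ext a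
    have h1 : r (a • f x) = a • x := by
      rw [← map_smul]
      exact LinearMap.congr_fun hr (a • x)
    simp [h1]

end CoDual

variable {k A B}

/-- The map `(φ ⊗ 1) : A ⊗ B → B`. -/
noncomputable def sliceLeft (φ : A →ₗ[k] k) : A ⊗[k] B →ₗ[k] B :=
  (TensorProduct.lid k B).toLinearMap ∘ₗ LinearMap.rTensor B φ

/-- The map `(1 ⊗ ψ) : A ⊗ B → A`. -/
noncomputable def sliceRight (ψ : B →ₗ[k] k) : A ⊗[k] B →ₗ[k] A :=
  (TensorProduct.rid k A).toLinearMap ∘ₗ LinearMap.lTensor A ψ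

@[simp] theorem sliceLeft_tmul (φ : A →ₗ[k] k) (x : A) (y : B) :
    sliceLeft φ (x ⊗ₜ[k] y) = φ x • y := by simp [sliceLeft]

@[simp] theorem sliceRight_tmul (ψ : B →ₗ[k] k) (x : A) (y : B) :
    sliceRight ψ (x ⊗ₜ[k] y) = ψ y • x := by simp [sliceRight]

theorem apply_sliceLeft (φ : A →ₗ[k] k) (ψ : B →ₗ[k] k) (c : A ⊗[k] B) :
    ψ (sliceLeft φ c) = φ (sliceRight ψ c) := by
  induction c using TensorProduct.induction_on with
  | zero => simp
  | tmul x y => simp [mul_comm]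
  | add x y hx hy => simp [hx, hy]

/-- Tensors `∑ xᵢ ⊗ yᵢ` with `∑ xᵢ a ⊗ yᵢ = ∑ xᵢ ⊗ a yᵢ` for all `a`. -/
def IsCasimir (c : A ⊗[k] A) : Prop := ∀ a : A, c * (a ⊗ₜ 1) = (1 ⊗ₜ a) * c

theorem sliceLeft_mul_tmul_one (φ : CoDual k A) (c : A ⊗[k] A) (a : A) :
    sliceLeft (CoDual.toDual k A φ) (c * (a ⊗ₜ 1)) =
      sliceLeft (CoDual.toDual k A (a • φ)) c := by
  induction c using TensorProduct.induction_on with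
  | zero => simp
  | tmul x y => simp
  | add x y hx hy => simp only [add_mul, map_add, hx, hy]

theorem sliceLeft_one_tmul_mul (φ : A →ₗ[k] k) (c : A ⊗[k] A) (a : A) :
    sliceLeft φ ((1 ⊗ₜ a) * c) = a * sliceLeft φ c := by
  induction c using TensorProduct.induction_on with
  | zero => simp
  | tmul x y => simp
  | add x y hx hy => simp only [mul_add, map_add, hx, hy]

/-- The `A`-linear map `CoDual k A → A` defined by a Casimir tensor. -/
noncomputable def IsCasimir.toHom {c : A ⊗[k] A} (hc : IsCasimir c) : CoDual k A →ₗ[A] A where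
  toFun φ := sliceLeft (CoDual.toDual k A φ) c
  map_add' φ ψ := by simp [sliceLeft, LinearMap.rTensor_add]
  map_smul' a φ := by
    rw [← sliceLeft_mul_tmul_one, hc a, sliceLeft_one_tmul_mul]
    rfl

theorem IsCasimir.toHom_apply {c : A ⊗[k] A} (hc : IsCasimir c) (φ : CoDual k A) :
    hc.toHom φ = sliceLeft (CoDual.toDual k A φ) c := rfl

theorem sum_basis_tmul_sliceLeft {ι : Type} [Fintype ι] (b : Module.Basis ι k A) (c : A ⊗[k] B) :
    ∑ i, b i ⊗ₜ[k] sliceLeft (b.coord i) c = c := by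
  induction c using TensorProduct.induction_on with
  | zero => simp
  | tmul x y =>
    conv_rhs => rw [← b.sum_repr x, TensorProduct.sum_tmul]
    simp [TensorProduct.smul_tmul]
  | add x y hx hy => simp only [map_add, TensorProduct.tmul_add, Finset.sum_add_distrib, hx, hy]

theorem ext_sliceLeft [FiniteDimensional k A] {c d : A ⊗[k] B}
    (h : ∀ φ : A →ₗ[k] k, sliceLeft φ c = sliceLeft φ d) :
    c = d := by
  rw [← sum_basis_tmul_sliceLeft (Module.finBasis k A) c,
    ← sum_basis_tmul_sliceLeft (Module.finBasis k A) d]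
  simp only [h]

theorem exists_isCasimir_toHom_eq [FiniteDimensional k A] (g : CoDual k A →ₗ[A] A) :
    ∃ (c : A ⊗[k] A) (hc : IsCasimir c), hc.toHom = g := by
  let b := Module.finBasis k A
  let δ (i) : CoDual k A := (CoDual.toDual k A).symm (b.coord i)
  let c : A ⊗[k] A := ∑ i, b i ⊗ₜ[k] g (δ i)
  have hg (φ : CoDual k A) : sliceLeft (CoDual.toDual k A φ) c = g φ := by
    have h1 : φ = ∑ i, CoDual.toDual k A φ (b i) • δ i := by
      apply (CoDual.toDual k A).injective
      simp only [map_sum, map_smul, δ, LinearEquiv.apply_symm_apply]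
      exact (b.sum_dual_apply_smul_coord _).symm
    conv_rhs => rw [h1, map_sum]
    simp only [c, map_sum, sliceLeft_tmul]
    refine Finset.sum_congr rfl fun i _ => ?_
    exact ((g.restrictScalars k).map_smul _ _).symm
  have hc : IsCasimir c := fun a => ext_sliceLeft fun φ => by
    obtain ⟨φ, rfl⟩ := (CoDual.toDual k A).surjective φ
    rw [sliceLeft_one_tmul_mul, sliceLeft_mul_tmul_one, hg, hg φ, map_smul, smul_eq_mul]
  exact ⟨c, hc, LinearMap.ext hg⟩

end Casimir

section QF

variable (k : Type) [Field k] (A B : Type) [Ring A] [Algebra k A] [Ring B] [Algebra k B]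

/-- The span of the left slices of Casimir tensors: the trace of `CoDual k A` in `A`. -/
noncomputable def leftCasimirSpan : Submodule k A :=
  Submodule.span k {u | ∃ (φ : A →ₗ[k] k) (c : A ⊗[k] A), IsCasimir c ∧ sliceLeft φ c = u}

/-- The span of the right slices of Casimir tensors. -/
noncomputable def rightCasimirSpan : Submodule k A :=
  Submodule.span k {u | ∃ (φ : A →ₗ[k] k) (c : A ⊗[k] A), IsCasimir c ∧ sliceRight φ c = u}

/-- A two-sided form of self-injectivity, visibly stable under opposites and tensor products. -/
structure IsQF : Prop where
  left : 1 ∈ leftCasimirSpan k A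
  right : 1 ∈ rightCasimirSpan k A

variable {k A B}

theorem one_mem_leftCasimirSpan [FiniteDimensional k A] (hA : Module.Injective A A) :
    1 ∈ leftCasimirSpan k A := by
  classical
  let b := Module.finBasis k A
  let f : A →ₗ[A] (Fin (Module.finrank k A) → CoDual k A) :=
    LinearMap.pi fun i => LinearMap.toSpanSingleton A _ ((CoDual.toDual k A).symm (b.coord i))
  have hf : Function.Injective f := by
    rw [injective_iff_map_eq_zero]
    intro a ha
    refine b.ext_elem fun i => ?_
    have := LinearMap.congr_fun (congrArg (CoDual.toDual k A) (congrFun ha i)) 1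
    simpa [f] using this
  obtain ⟨h, hh⟩ := Module.Injective.out f hf LinearMap.id
  have h1 : (1 : A) = h (f 1) := (hh 1).symm
  rw [h1, ← Finset.univ_sum_single (f 1), map_sum]
  refine Submodule.sum_mem _ fun i _ => Submodule.subset_span ?_
  obtain ⟨c, hc, hc'⟩ := exists_isCasimir_toHom_eq (k := k)
    (h ∘ₗ LinearMap.single A (fun _ => CoDual k A) i)
  exact ⟨CoDual.toDual k A (f 1 i), c, hc, LinearMap.congr_fun hc' (f 1 i)⟩

theorem one_mem_rightCasimirSpan [FiniteDimensional k A] (hA : Module.Injective A A) :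
    1 ∈ rightCasimirSpan k A := by
  classical
  obtain ⟨n, f, hf⟩ := exists_injective_pi_self k hA (CoDual k A)
  obtain ⟨h, hh⟩ := (CoDual.injective k A).out f hf LinearMap.id
  choose c hc hc' using fun i => exists_isCasimir_toHom_eq (LinearMap.proj i ∘ₗ f)
  let ψ (i : Fin n) : CoDual k A := h (Pi.single i 1)
  have key : ∑ i, sliceRight (CoDual.toDual k A (ψ i)) (c i) = 1 := by
    rw [← sub_eq_zero, ← Module.forall_dual_apply_eq_zero_iff k]
    intro φ
    obtain ⟨φ, rfl⟩ := (CoDual.toDual k A).surjective φ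
    have h1 : φ = ∑ i, f φ i • ψ i := by
      conv_lhs => rw [← LinearMap.id_apply (R := A) φ, ← hh φ, ← Finset.univ_sum_single (f φ)]
      rw [map_sum]
      refine Finset.sum_congr rfl fun i _ => ?_
      rw [← map_smul]
      congr 1
      ext j
      by_cases hij : j = i
      · subst hij; simp
      · simp [hij]
    have h2 (i : Fin n) : CoDual.toDual k A φ (sliceRight (CoDual.toDual k A (ψ i)) (c i)) =
        CoDual.toDual k A (ψ i) (f φ i) := by
      rw [← apply_sliceLeft, ← (hc i).toHom_apply, hc' i]
      rfl
    have h3 : CoDual.toDual k A φ 1 = ∑ i, CoDual.toDual k A (ψ i) (f φ i) := by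
      conv_lhs => rw [h1, ← CoDual.evalOne_apply, map_sum]
      simp
    rw [map_sub, map_sum, h3]
    simp [h2]
  rw [← key]
  exact Submodule.sum_mem _ fun i _ => Submodule.subset_span ⟨_, c i, hc i, rfl⟩

theorem IsQF.of_injective [FiniteDimensional k A] (hA : Module.Injective A A) : IsQF k A :=
  ⟨one_mem_leftCasimirSpan hA, one_mem_rightCasimirSpan hA⟩

theorem IsQF.injective_self (hA : IsQF k A) : Module.Injective A A where
  out X Y _ _ _ _ i hi f := by
    suffices H : ∀ u ∈ leftCasimirSpan k A, ∃ h : Y →ₗ[A] A, ∀ x, h (i x) = f x * u by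
      simpa using H 1 hA.left
    intro u hu
    induction hu using Submodule.span_induction with
    | mem u hu =>
      obtain ⟨φ, c, hc, rfl⟩ := hu
      obtain ⟨g, hg⟩ := (CoDual.injective k A).out i hi
        (LinearMap.toSpanSingleton A (CoDual k A) ((CoDual.toDual k A).symm φ) ∘ₗ f)
      refine ⟨hc.toHom ∘ₗ g, fun x => ?_⟩
      rw [LinearMap.comp_apply, hg]
      exact hc.toHom.map_smul (f x) _
    | zero => exact ⟨0, by simp⟩
    | add u v _ _ hu hv =>
      obtain ⟨g, hg⟩ := hu
      obtain ⟨h, hh⟩ := hv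
      exact ⟨g + h, fun x => by rw [LinearMap.add_apply, hg, hh, mul_add]⟩
    | smul r u _ hu =>
      obtain ⟨g, hg⟩ := hu
      refine ⟨LinearMap.toSpanSingleton A A (algebraMap k A r) ∘ₗ g, fun x => ?_⟩
      simp [hg, Algebra.smul_def, Algebra.commutes, mul_assoc]

/-- A retract of an injective module is injective. -/
theorem Module.Injective.of_retract {P Q : Type} [AddCommGroup P] [Module A P] [AddCommGroup Q]
    [Module A Q] (hQ : Module.Injective A Q) (s : P →ₗ[A] Q) (r : Q →ₗ[A] P)
    (hrs : r ∘ₗ s = LinearMap.id) : Module.Injective A P where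
  out X Y _ _ _ _ i hi f := by
    obtain ⟨h, hh⟩ := hQ.out i hi (s ∘ₗ f)
    refine ⟨r ∘ₗ h, fun x => ?_⟩
    rw [LinearMap.comp_apply, hh]
    exact LinearMap.congr_fun hrs (f x)

theorem Module.Injective.of_finite_projective (hA : Module.Injective A A) (P : Type)
    [AddCommGroup P] [Module A P] [Module.Finite A P] [Module.Projective A P] :
    Module.Injective A P := by
  obtain ⟨n, f, hf⟩ := Module.Finite.exists_fin' A P
  obtain ⟨s, hs⟩ := Module.projective_lifting_property f LinearMap.id hf
  exact .of_retract (inferInstanceAs (Module.Injective A (Fin n → A))) s f hs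

theorem IsQF.exists_injective_pi (hA : IsQF k A) [FiniteDimensional k A] (M : Type)
    [AddCommGroup M] [Module k M] [Module A M] [IsScalarTower k A M] [Module.Finite A M] :
    ∃ (n : ℕ) (f : M →ₗ[A] (Fin n → A)), Function.Injective f := by
  have : IsArtinianRing A := IsArtinianRing.of_finite k A
  refine exists_injective_pi_of_separating fun m hm => ?_
  rw [← Module.forall_dual_apply_eq_zero_iff k]
  intro h
  suffices H : ∀ u ∈ rightCasimirSpan k A, h (u • m) = 0 by simpa using H 1 hA.right
  intro u hu
  induction hu using Submodule.span_induction with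
  | mem u hu =>
    obtain ⟨ψ, c, hc, rfl⟩ := hu
    have h1 : sliceLeft (CoDual.toDual k A (CoDual.coextend h m)) c = 0 :=
      hm (hc.toHom ∘ₗ CoDual.coextend h)
    have h2 := apply_sliceLeft (CoDual.toDual k A (CoDual.coextend h m)) ψ c
    rw [h1, map_zero, CoDual.toDual_coextend] at h2
    exact h2.symm
  | zero => simp
  | add u v _ _ hu hv => rw [add_smul, map_add, hu, hv, add_zero]
  | smul r u _ hu => rw [smul_assoc, map_smul, hu, smul_zero]

/-- The flip `x ⊗ y ↦ yᵒᵖ ⊗ xᵒᵖ`. -/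
noncomputable def opFlip : A ⊗[k] A →ₗ[k] Aᵐᵒᵖ ⊗[k] Aᵐᵒᵖ :=
  TensorProduct.map (opLinearEquiv k).toLinearMap (opLinearEquiv k).toLinearMap ∘ₗ
    (TensorProduct.comm k A A).toLinearMap

@[simp] theorem opFlip_tmul (x y : A) : opFlip (x ⊗ₜ[k] y) = op y ⊗ₜ[k] op x := by simp [opFlip]

theorem IsCasimir.opFlip {c : A ⊗[k] A} (hc : IsCasimir c) : IsCasimir (opFlip c) := by
  intro a
  have h1 : ∀ c : A ⊗[k] A, _root_.opFlip c * (a ⊗ₜ 1) = _root_.opFlip ((1 ⊗ₜ a.unop) * c) := by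
    intro c
    induction c using TensorProduct.induction_on with
    | zero => simp
    | tmul x y => simp
    | add x y hx hy => simp only [map_add, add_mul, mul_add, hx, hy]
  have h2 : ∀ c : A ⊗[k] A, (1 ⊗ₜ a) * _root_.opFlip c = _root_.opFlip (c * (a.unop ⊗ₜ 1)) := by
    intro c
    induction c using TensorProduct.induction_on with
    | zero => simp
    | tmul x y => simp
    | add x y hx hy => simp only [map_add, add_mul, mul_add, hx, hy]
  rw [h1, h2, hc]

theorem sliceLeft_opFlip (φ : A →ₗ[k] k) (c : A ⊗[k] A) :
    sliceLeft (φ ∘ₗ (opLinearEquiv k).symm.toLinearMap) (opFlip c) = op (sliceRight φ c) := by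
  induction c using TensorProduct.induction_on with
  | zero => simp
  | tmul x y => simp
  | add x y hx hy => simp only [map_add, hx, hy, op_add]

theorem sliceRight_opFlip (φ : A →ₗ[k] k) (c : A ⊗[k] A) :
    sliceRight (φ ∘ₗ (opLinearEquiv k).symm.toLinearMap) (opFlip c) = op (sliceLeft φ c) := by
  induction c using TensorProduct.induction_on with
  | zero => simp
  | tmul x y => simp
  | add x y hx hy => simp only [map_add, hx, hy, op_add]

theorem IsQF.mulOpposite (hA : IsQF k A) : IsQF k Aᵐᵒᵖ where
  left := by
    have : (rightCasimirSpan k A).map (opLinearEquiv k).toLinearMap ≤ leftCasimirSpan k Aᵐᵒᵖ := by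
      rw [rightCasimirSpan, Submodule.map_span_le]
      rintro _ ⟨φ, c, hc, rfl⟩
      exact Submodule.subset_span ⟨_, _, hc.opFlip, sliceLeft_opFlip φ c⟩
    exact this ⟨1, hA.right, rfl⟩
  right := by
    have : (leftCasimirSpan k A).map (opLinearEquiv k).toLinearMap ≤ rightCasimirSpan k Aᵐᵒᵖ := by
      rw [leftCasimirSpan, Submodule.map_span_le]
      rintro _ ⟨φ, c, hc, rfl⟩
      exact Submodule.subset_span ⟨_, _, hc.opFlip, sliceRight_opFlip φ c⟩
    exact this ⟨1, hA.left, rfl⟩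

/-- The isomorphism `(A ⊗ A) ⊗ (B ⊗ B) ≃ (A ⊗ B) ⊗ (A ⊗ B)` applied to a pure tensor. -/
noncomputable def interleave (c : A ⊗[k] A) (d : B ⊗[k] B) : (A ⊗[k] B) ⊗[k] (A ⊗[k] B) :=
  Algebra.TensorProduct.tensorTensorTensorComm k k k k A A B B (c ⊗ₜ d)

theorem IsCasimir.interleave {c : A ⊗[k] A} {d : B ⊗[k] B} (hc : IsCasimir c) (hd : IsCasimir d) :
    IsCasimir (interleave c d) := by
  intro r
  induction r using TensorProduct.induction_on with
  | zero => simp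
  | add x y hx hy => rw [TensorProduct.add_tmul, TensorProduct.tmul_add, mul_add, add_mul, hx, hy]
  | tmul a b =>
    have h1 : ((a ⊗ₜ[k] b) ⊗ₜ[k] 1 : (A ⊗[k] B) ⊗[k] (A ⊗[k] B)) =
        Algebra.TensorProduct.tensorTensorTensorComm k k k k A A B B ((a ⊗ₜ 1) ⊗ₜ (b ⊗ₜ 1)) := by
      simp [Algebra.TensorProduct.one_def]
    have h2 : (1 ⊗ₜ[k] (a ⊗ₜ[k] b) : (A ⊗[k] B) ⊗[k] (A ⊗[k] B)) =
        Algebra.TensorProduct.tensorTensorTensorComm k k k k A A B B ((1 ⊗ₜ a) ⊗ₜ (1 ⊗ₜ b)) := by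
      simp [Algebra.TensorProduct.one_def]
    rw [_root_.interleave, h1, h2, ← map_mul, ← map_mul, Algebra.TensorProduct.tmul_mul_tmul,
      Algebra.TensorProduct.tmul_mul_tmul, hc, hd]

theorem sliceLeft_interleave (φ : A →ₗ[k] k) (χ : B →ₗ[k] k) (c : A ⊗[k] A) (d : B ⊗[k] B) :
    sliceLeft (LinearMap.mul' k k ∘ₗ TensorProduct.map φ χ) (interleave c d) =
      sliceLeft φ c ⊗ₜ sliceLeft χ d := by
  unfold interleave
  induction c using TensorProduct.induction_on with
  | zero => simp
  | add x y hx hy => simp only [TensorProduct.add_tmul, map_add, hx, hy]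
  | tmul x y =>
    induction d using TensorProduct.induction_on with
    | zero => simp
    | add x y hx hy => simp only [TensorProduct.tmul_add, map_add, hx, hy]
    | tmul z w => simp [TensorProduct.smul_tmul, TensorProduct.tmul_smul, smul_smul, mul_comm]

theorem sliceRight_interleave (φ : A →ₗ[k] k) (χ : B →ₗ[k] k) (c : A ⊗[k] A) (d : B ⊗[k] B) :
    sliceRight (LinearMap.mul' k k ∘ₗ TensorProduct.map φ χ) (interleave c d) =
      sliceRight φ c ⊗ₜ sliceRight χ d := by
  unfold interleave
  induction c using TensorProduct.induction_on with
  | zero => simp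
  | add x y hx hy => simp only [TensorProduct.add_tmul, map_add, hx, hy]
  | tmul x y =>
    induction d using TensorProduct.induction_on with
    | zero => simp
    | add x y hx hy => simp only [TensorProduct.tmul_add, map_add, hx, hy]
    | tmul z w => simp [TensorProduct.smul_tmul, TensorProduct.tmul_smul, smul_smul, mul_comm]

theorem IsQF.tensorProduct (hA : IsQF k A) (hB : IsQF k B) : IsQF k (A ⊗[k] B) where
  left := by
    have : Submodule.map₂ (TensorProduct.mk k A B) (leftCasimirSpan k A) (leftCasimirSpan k B) ≤
        leftCasimirSpan k (A ⊗[k] B) := by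
      rw [leftCasimirSpan, leftCasimirSpan, Submodule.map₂_span_span, Submodule.span_le]
      rintro _ ⟨_, ⟨φ, c, hc, rfl⟩, _, ⟨χ, d, hd, rfl⟩, rfl⟩
      exact Submodule.subset_span ⟨_, _, hc.interleave hd, sliceLeft_interleave φ χ c d⟩
    exact this (Submodule.apply_mem_map₂ _ hA.left hB.left)
  right := by
    have : Submodule.map₂ (TensorProduct.mk k A B) (rightCasimirSpan k A) (rightCasimirSpan k B) ≤
        rightCasimirSpan k (A ⊗[k] B) := by
      rw [rightCasimirSpan, rightCasimirSpan, Submodule.map₂_span_span, Submodule.span_le]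
      rintro _ ⟨_, ⟨φ, c, hc, rfl⟩, _, ⟨χ, d, hd, rfl⟩, rfl⟩
      exact Submodule.subset_span ⟨_, _, hc.interleave hd, sliceRight_interleave φ χ c d⟩
    exact this (Submodule.apply_mem_map₂ _ hA.right hB.right)

end QF

section OneSided

variable {k : Type} [Field k] {A R S : Type} [Ring A] [Ring R] [Ring S] [Algebra k A] [Algebra k R]
  [Algebra k S]

/-- A retraction onto a finitely generated projective module over a self-injective algebra. -/
theorem exists_retraction (φ : A →ₐ[k] R) (hA : Module.Injective A A) {X E : Type}
    [AddCommGroup X] [Module k X] [Module R X] [IsScalarTower k R X]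
    [AddCommGroup E] [Module k E] [Module R E] [IsScalarTower k R E]
    (hX : letI := Module.compHom X φ.toRingHom; Module.Finite A X ∧ Module.Projective A X)
    (i : X →ₗ[R] E) (hi : Function.Injective i) :
    ∃ ρ : E →ₗ[k] X, (∀ a e, ρ (φ a • e) = φ a • ρ e) ∧ ∀ x, ρ (i x) = x := by
  let := Module.compHom X φ.toRingHom
  let := Module.compHom E φ.toRingHom
  have := hX.1
  have := hX.2
  let i' : X →ₗ[A] E :=
    { toFun := i, map_add' := map_add i, map_smul' := fun a x => map_smul i (φ a) x }
  obtain ⟨r, hr⟩ := (Module.Injective.of_finite_projective hA X).out i' hi LinearMap.id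
  refine ⟨{ toFun := r, map_add' := map_add r, map_smul' := fun c e => ?_ },
    fun a e => map_smul r a e, hr⟩
  have h := map_smul r (algebraMap k A c) e
  change r (φ (algebraMap k A c) • e) = φ (algebraMap k A c) • r e at h
  simpa using h

/-- The section of a cokernel associated with a retraction. -/
theorem exists_section (φ : A →ₐ[k] R) {X E Y : Type}
    [AddCommGroup X] [Module k X] [Module R X] [IsScalarTower k R X]
    [AddCommGroup E] [Module k E] [Module R E] [IsScalarTower k R E]
    [AddCommGroup Y] [Module k Y] [Module R Y] [IsScalarTower k R Y]
    (i : X →ₗ[R] E) (p : E →ₗ[R] Y) (hip : Function.Exact i p) (hp : Function.Surjective p)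
    (ρ : E →ₗ[k] X) (hρ : ∀ a e, ρ (φ a • e) = φ a • ρ e) (hρi : ∀ x, ρ (i x) = x) :
    ∃ s : Y →ₗ[k] E, (∀ a y, s (φ a • y) = φ a • s y) ∧ (∀ y, p (s y) = y) ∧
      ∀ e, i (ρ e) + s (p e) = e := by
  choose g hg using hp
  have key : ∀ e, g (p e) - i (ρ (g (p e))) = e - i (ρ e) := fun e => by
    obtain ⟨x, hx⟩ := (hip (g (p e) - e)).1 (by rw [map_sub, hg, sub_self])
    have h : g (p e) = e + i x := by rw [hx]; abel
    rw [h, map_add, map_add, hρi]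
    abel
  have key' : ∀ y e, p e = y → g y - i (ρ (g y)) = e - i (ρ e) := by
    rintro _ e rfl
    exact key e
  refine ⟨{ toFun := fun y => g y - i (ρ (g y)), map_add' := fun y z => ?_,
            map_smul' := fun c y => ?_ }, fun a y => ?_, fun y => ?_, fun e => ?_⟩
  · rw [key' (y + z) (g y + g z) (by rw [map_add, hg, hg]), map_add, map_add]
    abel
  · rw [key' (c • y) (c • g y) (by rw [LinearMap.map_smul_of_tower, hg]), map_smul,
      LinearMap.map_smul_of_tower, smul_sub, RingHom.id_apply]
  · change g _ - i (ρ (g _)) = φ a • (g y - i (ρ (g y)))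
    rw [key' (φ a • y) (φ a • g y) (by rw [map_smul, hg]), hρ, map_smul, smul_sub]
  · change p (g y - i (ρ (g y))) = y
    rw [map_sub, hg, hip.apply_apply_eq_zero, sub_zero]
  · change i (ρ e) + (g _ - i (ρ (g _))) = e
    rw [key]
    abel

theorem exists_lift (φ : A →ₐ[k] R) (ψ : A →ₐ[k] S) {X F P : Type}
    [AddCommGroup X] [Module k X] [Module R X] [IsScalarTower k R X]
    [AddCommGroup F] [Module k F] [Module S F] [IsScalarTower k S F]
    [AddCommGroup P] [Module k P] [Module S P] [IsScalarTower k S P]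
    (hX : letI := Module.compHom X φ.toRingHom; Module.Projective A X)
    (f : F →ₗ[S] P) (hf : Function.Surjective f)
    (t : X →ₗ[k] P) (ht : ∀ a x, t (φ a • x) = ψ a • t x) :
    ∃ h : X →ₗ[k] F, (∀ a x, h (φ a • x) = ψ a • h x) ∧ ∀ x, f (h x) = t x := by
  let := Module.compHom X φ.toRingHom
  let := Module.compHom F ψ.toRingHom
  let := Module.compHom P ψ.toRingHom
  let f' : F →ₗ[A] P :=
    { toFun := f, map_add' := map_add f, map_smul' := fun a x => map_smul f (ψ a) x }
  let t' : X →ₗ[A] P :=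
    { toFun := t, map_add' := map_add t, map_smul' := ht }
  obtain ⟨h, hh⟩ := Module.projective_lifting_property f' t' hf
  refine ⟨{ toFun := h, map_add' := map_add h, map_smul' := fun c x => ?_ },
    fun a x => map_smul h a x, fun x => LinearMap.congr_fun hh x⟩
  have hc := map_smul h (algebraMap k A c) x
  change h (φ (algebraMap k A c) • x) = ψ (algebraMap k A c) • h x at hc
  simpa using hc

theorem finite_compHom (φ : A →ₐ[k] R) (X : Type) [AddCommGroup X] [Module k X] [Module R X]
    [IsScalarTower k R X] [FiniteDimensional k X] :
    letI := Module.compHom X φ.toRingHom; Module.Finite A X := by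
  let := Module.compHom X φ.toRingHom
  have : IsScalarTower k A X := ⟨fun c a x => by
    change φ (c • a) • x = c • φ a • x
    rw [map_smul, smul_assoc]⟩
  exact Module.Finite.of_restrictScalars_finite k A X

theorem finiteDimensional_of_compHom [FiniteDimensional k A] (φ : A →ₐ[k] R) (X : Type)
    [AddCommGroup X] [Module k X] [Module R X] [IsScalarTower k R X]
    (hX : letI := Module.compHom X φ.toRingHom; Module.Finite A X) : FiniteDimensional k X := by
  let := Module.compHom X φ.toRingHom
  have : IsScalarTower k A X := ⟨fun c a x => by
    change φ (c • a) • x = c • φ a • x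
    rw [map_smul, smul_assoc]⟩
  exact Module.Finite.trans A X

theorem projective_compHom_of_retract (φ : A →ₐ[k] R) {E Y : Type}
    [AddCommGroup E] [Module k E] [Module R E] [AddCommGroup Y] [Module k Y] [Module R Y]
    (hE : letI := Module.compHom E φ.toRingHom; Module.Projective A E)
    (p : E →ₗ[R] Y) (s : Y →ₗ[k] E) (hs : ∀ a y, s (φ a • y) = φ a • s y)
    (hps : ∀ y, p (s y) = y) :
    letI := Module.compHom Y φ.toRingHom; Module.Projective A Y := by
  let := Module.compHom E φ.toRingHom
  let := Module.compHom Y φ.toRingHom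
  let p' : E →ₗ[A] Y :=
    { toFun := p, map_add' := map_add p, map_smul' := fun a x => map_smul p (φ a) x }
  let s' : Y →ₗ[A] E := { toFun := s, map_add' := map_add s, map_smul' := hs }
  exact Module.Projective.of_split s' p' (LinearMap.ext hps)

theorem projective_compHom_pi (φ : A →ₐ[k] R)
    (hR : letI := Module.compHom R φ.toRingHom; Module.Projective A R) (n : ℕ) :
    letI := Module.compHom (Fin n → R) φ.toRingHom; Module.Projective A (Fin n → R) := by
  let := Module.compHom R φ.toRingHom
  exact Module.Projective.of_equiv
    (DFinsupp.linearEquivFunOnFintype (R := A) (M := fun _ : Fin n => R))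

variable (k) in
theorem projective_leftRestrict_tensorProduct (A B : Type) [Ring A] [Ring B] [Algebra k A]
    [Algebra k B] :
    letI := leftRestrict k A B (A ⊗[k] Bᵐᵒᵖ); Module.Projective A (A ⊗[k] Bᵐᵒᵖ) := by
  have h : leftRestrict k A B (A ⊗[k] Bᵐᵒᵖ) = TensorProduct.leftModule := by
    refine Module.ext' _ _ fun a x => ?_
    change (a ⊗ₜ[k] (1 : Bᵐᵒᵖ)) * x = _
    induction x using TensorProduct.induction_on with
    | zero => simp
    | tmul x y => simp [TensorProduct.smul_tmul']
    | add x y hx hy => rw [mul_add, hx, hy, smul_add]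
  rw [h]
  infer_instance

variable (k) in
theorem projective_rightRestrict_tensorProduct (A B : Type) [Ring A] [Ring B] [Algebra k A]
    [Algebra k B] :
    letI := rightRestrict k A B (A ⊗[k] Bᵐᵒᵖ); Module.Projective Bᵐᵒᵖ (A ⊗[k] Bᵐᵒᵖ) := by
  let := rightRestrict k A B (A ⊗[k] Bᵐᵒᵖ)
  let e := TensorProduct.comm k Bᵐᵒᵖ A
  refine Module.Projective.of_equiv (M := Bᵐᵒᵖ ⊗[k] A) (R := Bᵐᵒᵖ) (σ := RingHom.id _)
    { e with map_smul' := fun b x => ?_ }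
  change e (b • x) = ((1 : A) ⊗ₜ[k] b) * e x
  induction x using TensorProduct.induction_on with
  | zero => simp
  | tmul x y => simp [TensorProduct.smul_tmul', e]
  | add x y hx hy => rw [smul_add, map_add, hx, hy, map_add, mul_add]

end OneSided

section Schanuel

variable {S : Type} [Ring S]

/-- The dual of Schanuel's lemma. -/
theorem nonempty_linearEquiv_of_injective_coresolutions {X₁ X₂ E₁ E₂ C₁ C₂ : Type}
    [AddCommGroup X₁] [Module S X₁] [AddCommGroup X₂] [Module S X₂]
    [AddCommGroup E₁] [Module S E₁] [AddCommGroup E₂] [Module S E₂]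
    [AddCommGroup C₁] [Module S C₁] [AddCommGroup C₂] [Module S C₂]
    (hE₁ : Module.Injective S E₁) (hE₂ : Module.Injective S E₂)
    (i₁ : X₁ →ₗ[S] E₁) (i₂ : X₂ →ₗ[S] E₂) (hi₁ : Function.Injective i₁)
    (hi₂ : Function.Injective i₂) (p₁ : E₁ →ₗ[S] C₁) (p₂ : E₂ →ₗ[S] C₂)
    (hp₁ : Function.Surjective p₁) (hp₂ : Function.Surjective p₂)
    (h₁ : Function.Exact i₁ p₁) (h₂ : Function.Exact i₂ p₂) (e : X₁ ≃ₗ[S] X₂) :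
    Nonempty ((C₁ × E₂) ≃ₗ[S] (C₂ × E₁)) := by
  obtain ⟨f, hf⟩ := hE₂.out i₁ hi₁ (i₂ ∘ₗ e.toLinearMap)
  obtain ⟨g, hg⟩ := hE₁.out i₂ hi₂ (i₁ ∘ₗ e.symm.toLinearMap)
  let q₁ : E₁ × E₂ →ₗ[S] C₁ × E₂ := LinearMap.prodMap p₁ LinearMap.id
  let q₂ : E₁ × E₂ →ₗ[S] C₂ × E₁ :=
    (p₂ ∘ₗ (LinearMap.snd S E₁ E₂ + f ∘ₗ LinearMap.fst S E₁ E₂)).prod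
      (LinearMap.fst S E₁ E₂ - g ∘ₗ (LinearMap.snd S E₁ E₂ + f ∘ₗ LinearMap.fst S E₁ E₂))
  have hq₁ : Function.Surjective q₁ := hp₁.prodMap Function.surjective_id
  have hq₂ : Function.Surjective q₂ := by
    rintro ⟨c, x⟩
    obtain ⟨y, rfl⟩ := hp₂ c
    refine ⟨(x + g y, y - f (x + g y)), ?_⟩
    simp [q₂]
  have hker : LinearMap.ker q₁ = LinearMap.ker q₂ := by
    ext ⟨x, y⟩
    change (p₁ x, y) = 0 ↔ (p₂ (y + f x), x - g (y + f x)) = 0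
    rw [Prod.mk_eq_zero, Prod.mk_eq_zero]
    constructor
    · rintro ⟨hx, rfl⟩
      obtain ⟨z, rfl⟩ := (h₁ x).1 hx
      simp [hf, hg, h₂.apply_apply_eq_zero]
    · rintro ⟨hy, hx⟩
      obtain ⟨z, hz⟩ := (h₂ _).1 hy
      have hx' : x = i₁ (e.symm z) := by
        rw [← hz, hg, sub_eq_zero] at hx
        exact hx
      subst hx'
      refine ⟨h₁.apply_apply_eq_zero _, ?_⟩
      rw [hf] at hz
      simpa using hz.symm
  exact ⟨(q₁.quotKerEquivOfSurjective hq₁).symm ≪≫ₗ Submodule.quotEquivOfEq _ _ hker ≪≫ₗ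
    q₂.quotKerEquivOfSurjective hq₂⟩

/-- Over a self-injective ring, cosyzygies of stably isomorphic modules are stably isomorphic. -/
theorem StablyIso.of_isSyzygyOf (hS : Module.Injective S S) {X E C : Type}
    [AddCommGroup X] [Module S X] [AddCommGroup E] [Module S E] [AddCommGroup C] [Module S C]
    [Module.Finite S E] [Module.Projective S E] (i : X →ₗ[S] E) (p : E →ₗ[S] C)
    (hi : Function.Injective i) (hp : Function.Surjective p) (hip : Function.Exact i p)
    {Z W : ModuleCat.{0} S} (hZ : IsSyzygyOf S Z W) (hX : StablyIso S X Z) :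
    StablyIso S C W := by
  obtain ⟨P, Q, _, _, _, _, ⟨e⟩⟩ := hX
  obtain ⟨T, q, ⟨_, _, hq, -⟩, ⟨d⟩⟩ := hZ
  let j : Z →ₗ[S] T := (LinearMap.ker q).subtype ∘ₗ d.toLinearMap
  have hj : Function.Injective j := (LinearMap.ker q).injective_subtype.comp d.injective
  have hjq : Function.Exact j q := fun y => by
    refine ⟨fun hy => ⟨d.symm ⟨y, hy⟩, by simp [j]⟩, ?_⟩
    rintro ⟨z, rfl⟩
    exact (d z).2
  refine ⟨ModuleCat.of S (T × Q), ModuleCat.of S (E × P), inferInstanceAs (Module.Finite S (T × Q)),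
    inferInstanceAs (Module.Projective S (T × Q)), inferInstanceAs (Module.Finite S (E × P)),
    inferInstanceAs (Module.Projective S (E × P)), ?_⟩
  refine nonempty_linearEquiv_of_injective_coresolutions (.of_finite_projective hS _)
    (.of_finite_projective hS _) (i.prodMap LinearMap.id) (j.prodMap LinearMap.id)
    (hi.prodMap Function.injective_id) (hj.prodMap Function.injective_id)
    (p ∘ₗ LinearMap.fst S E P) (q ∘ₗ LinearMap.fst S T Q) (hp.comp Prod.fst_surjective)
    (hq.comp Prod.fst_surjective) ?_ ?_ e
  · rintro ⟨x, y⟩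
    simp only [LinearMap.comp_apply, LinearMap.fst_apply, hip x]
    constructor
    · rintro ⟨z, rfl⟩
      exact ⟨(z, y), rfl⟩
    · rintro ⟨⟨z, w⟩, h⟩
      exact ⟨z, congrArg Prod.fst h⟩
  · rintro ⟨x, y⟩
    simp only [LinearMap.comp_apply, LinearMap.fst_apply, hjq x]
    constructor
    · rintro ⟨z, rfl⟩
      exact ⟨(z, y), rfl⟩
    · rintro ⟨⟨z, w⟩, h⟩
      exact ⟨z, congrArg Prod.fst h⟩

end Schanuel

namespace BTensor

variable {k : Type} [Field k]
  {A B C : Type} [Ring A] [Ring B] [Ring C] [Algebra k A] [Algebra k B] [Algebra k C]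
  {X : Type} [AddCommGroup X] [Module k X] [Module (A ⊗[k] Bᵐᵒᵖ) X]
  [IsScalarTower k (A ⊗[k] Bᵐᵒᵖ) X]
  {Y : Type} [AddCommGroup Y] [Module k Y] [Module (B ⊗[k] Cᵐᵒᵖ) Y]
  [IsScalarTower k (B ⊗[k] Cᵐᵒᵖ) Y]
  {Z : Type} [AddCommGroup Z] [Module k Z]

theorem outerAction_tmul (a : A) (c : Cᵐᵒᵖ) (x : X) (y : Y) :
    outerAction k A B C X Y (a ⊗ₜ[k] c) (x ⊗ₜ[k] y) =
      ((a ⊗ₜ[k] (1 : Bᵐᵒᵖ)) • x) ⊗ₜ[k] (((1 : B) ⊗ₜ[k] c) • y) := by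
  simp [outerAction, lTensorAlgHom, rTensorAlgHom]

variable (k A B C X Y) in
/-- The quotient map onto the balanced tensor product. -/
noncomputable def mkHom : X ⊗[k] Y →ₗ[k] BTensor k A B C X Y :=
  letI := outerModule k A B C X Y
  { toFun := fun z => (balancedSub k A B C X Y).mkQ z
    map_add' := fun z w => map_add (balancedSub k A B C X Y).mkQ z w
    map_smul' := fun c z => by
      have h : c • z = algebraMap k (A ⊗[k] Cᵐᵒᵖ) c • z := by
        change _ = outerAction k A B C X Y (algebraMap k (A ⊗[k] Cᵐᵒᵖ) c) z
        rw [AlgHom.commutes, Module.algebraMap_end_apply]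
      rw [h, map_smul]
      rfl }

theorem mkHom_surjective : Function.Surjective (mkHom k A B C X Y) :=
  letI := outerModule k A B C X Y
  (balancedSub k A B C X Y).mkQ_surjective

theorem mkHom_outerAction (s : A ⊗[k] Cᵐᵒᵖ) (z : X ⊗[k] Y) :
    mkHom k A B C X Y (outerAction k A B C X Y s z) = s • mkHom k A B C X Y z :=
  letI := outerModule k A B C X Y
  map_smul (balancedSub k A B C X Y).mkQ s z

variable (k A B C) in
/-- The class of `x ⊗ y` in the balanced tensor product. -/
noncomputable def tmul (x : X) (y : Y) : BTensor k A B C X Y := mkHom k A B C X Y (x ⊗ₜ y)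

theorem add_tmul (x x' : X) (y : Y) :
    tmul k A B C (x + x') y = tmul k A B C x y + tmul k A B C x' y := by
  simp [tmul, TensorProduct.add_tmul]

theorem tmul_add (x : X) (y y' : Y) :
    tmul k A B C x (y + y') = tmul k A B C x y + tmul k A B C x y' := by
  simp [tmul, TensorProduct.tmul_add]

theorem smul_tmul (a : A) (c : Cᵐᵒᵖ) (x : X) (y : Y) :
    (a ⊗ₜ[k] c) • tmul k A B C x y =
      tmul k A B C ((a ⊗ₜ[k] (1 : Bᵐᵒᵖ)) • x) (((1 : B) ⊗ₜ[k] c) • y) := by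
  rw [tmul, ← mkHom_outerAction, outerAction_tmul, tmul]

theorem balanced (x : X) (b : B) (y : Y) :
    tmul k A B C (((1 : A) ⊗ₜ[k] op b) • x) y = tmul k A B C x ((b ⊗ₜ[k] (1 : Cᵐᵒᵖ)) • y) := by
  let := outerModule k A B C X Y
  rw [← sub_eq_zero, tmul, tmul, ← map_sub]
  exact (Submodule.Quotient.mk_eq_zero _).2 (Submodule.subset_span ⟨x, b, y, rfl⟩)

@[elab_as_elim]
theorem induction_on {motive : BTensor k A B C X Y → Prop} (z : BTensor k A B C X Y)
    (zero : motive 0) (tmul : ∀ x y, motive (tmul k A B C x y))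
    (add : ∀ z w, motive z → motive w → motive (z + w)) : motive z := by
  obtain ⟨z, rfl⟩ := mkHom_surjective z
  induction z using TensorProduct.induction_on with
  | zero => simpa using zero
  | tmul x y => exact tmul x y
  | add z w hz hw => simpa using add _ _ hz hw

theorem outer_comm (a : A) (b : B) (x : X) :
    (a ⊗ₜ[k] (1 : Bᵐᵒᵖ)) • ((1 : A) ⊗ₜ[k] op b) • x =
      ((1 : A) ⊗ₜ[k] op b) • (a ⊗ₜ[k] (1 : Bᵐᵒᵖ)) • x := by
  simp [← mul_smul]

/-- A balanced bilinear map factors through the balanced tensor product. -/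
theorem exists_lift (F : X →ₗ[k] Y →ₗ[k] Z)
    (hF : ∀ (x : X) (b : B) (y : Y),
      F (((1 : A) ⊗ₜ[k] op b) • x) y = F x ((b ⊗ₜ[k] (1 : Cᵐᵒᵖ)) • y)) :
    ∃ f : BTensor k A B C X Y →ₗ[k] Z, ∀ x y, f (tmul k A B C x y) = F x y := by
  let := outerModule k A B C X Y
  let G := TensorProduct.lift F
  have hG : ∀ z ∈ balancedSub k A B C X Y, ∀ s, G (outerAction k A B C X Y s z) = 0 := by
    intro z hz
    induction hz using Submodule.span_induction with
    | mem z hz =>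
      obtain ⟨x, b, y, rfl⟩ := hz
      intro s
      induction s using TensorProduct.induction_on with
      | zero => simp
      | add s t hs ht => rw [map_add, LinearMap.add_apply, map_add, hs, ht, add_zero]
      | tmul a c =>
        have h := outer_comm (k := k) (X := Y) b c.unop y
        rw [op_unop] at h
        rw [map_sub, outerAction_tmul, outerAction_tmul, outer_comm, map_sub, ← h]
        simp [G, hF]
    | zero => simp
    | add z w _ _ hz hw => intro s; rw [map_add, map_add, hz, hw, add_zero]
    | smul r z _ hz =>
      intro s
      have h : outerAction k A B C X Y s (r • z) = outerAction k A B C X Y (s * r) z := by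
        rw [map_mul]
        rfl
      rw [h, hz]
  have hker : ∀ z, mkHom k A B C X Y z = 0 → G z = 0 := fun z hz => by
    have := hG z ((Submodule.Quotient.mk_eq_zero _).1 hz) 1
    simpa using this
  have hker' : ∀ z w, mkHom k A B C X Y z = mkHom k A B C X Y w → G z = G w := fun z w h => by
    rw [← sub_eq_zero, ← map_sub]
    exact hker _ (by rw [map_sub, h, sub_self])
  choose g hg using mkHom_surjective (k := k) (A := A) (B := B) (C := C) (X := X) (Y := Y)
  refine ⟨{ toFun := fun z => G (g z), map_add' := fun z w => ?_, map_smul' := fun c z => ?_ },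
    fun x y => ?_⟩
  · rw [← map_add]
    exact hker' _ _ (by rw [map_add, hg, hg, hg])
  · rw [RingHom.id_apply, ← map_smul]
    exact hker' _ _ (by rw [map_smul, hg, hg])
  · exact (hker' _ (x ⊗ₜ y) (hg _)).trans (by simp [G])

/-- A balanced bilinear map compatible with the outer actions induces a bimodule map. -/
theorem exists_linear_lift [Module (A ⊗[k] Cᵐᵒᵖ) Z] [IsScalarTower k (A ⊗[k] Cᵐᵒᵖ) Z]
    (F : X →ₗ[k] Y →ₗ[k] Z)
    (hF : ∀ (x : X) (b : B) (y : Y),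
      F (((1 : A) ⊗ₜ[k] op b) • x) y = F x ((b ⊗ₜ[k] (1 : Cᵐᵒᵖ)) • y))
    (hF' : ∀ (a : A) (c : Cᵐᵒᵖ) (x : X) (y : Y),
      F ((a ⊗ₜ[k] (1 : Bᵐᵒᵖ)) • x) (((1 : B) ⊗ₜ[k] c) • y) =
      (a ⊗ₜ[k] c) • F x y) :
    ∃ f : BTensor k A B C X Y →ₗ[A ⊗[k] Cᵐᵒᵖ] Z, ∀ x y, f (tmul k A B C x y) = F x y := by
  obtain ⟨f, hf⟩ := exists_lift F hF
  refine ⟨{ toFun := f, map_add' := map_add f, map_smul' := fun s z => ?_ }, hf⟩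
  change f (s • z) = s • f z
  induction z using induction_on with
  | zero => rw [smul_zero, map_zero, smul_zero]
  | add z w hz hw => rw [smul_add, map_add, hz, hw, map_add, smul_add]
  | tmul x y =>
    induction s using TensorProduct.induction_on with
    | zero =>
      have h₁ := zero_smul (A ⊗[k] Cᵐᵒᵖ) (tmul k A B C x y)
      have h₂ := zero_smul (A ⊗[k] Cᵐᵒᵖ) (f (tmul k A B C x y))
      exact (congrArg f h₁).trans ((map_zero f).trans h₂.symm)
    | add s t hs ht => rw [add_smul, map_add, hs, ht, add_smul]
    | tmul a c => rw [smul_tmul, hf, hf, hF']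

theorem finiteDimensional [FiniteDimensional k X] [FiniteDimensional k Y] :
    FiniteDimensional k (BTensor k A B C X Y) :=
  Module.Finite.of_surjective (mkHom k A B C X Y) mkHom_surjective

end BTensor

theorem exact_of_split {S U V W : Type} [Ring S] [AddCommGroup U] [AddCommGroup V]
    [AddCommGroup W] [Module S U] [Module S V] [Module S W] (i : U →ₗ[S] V) (p : V →ₗ[S] W)
    (r : V → U) (s : W → V) (hri : ∀ u, r (i u) = u) (hps : ∀ w, p (s w) = w)
    (hs : s 0 = 0) (h : ∀ v, i (r v) + s (p v) = v) :
    Function.Injective i ∧ Function.Surjective p ∧ Function.Exact i p := by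
  refine ⟨Function.LeftInverse.injective hri, Function.RightInverse.surjective hps, fun v => ?_⟩
  constructor
  · intro hv
    refine ⟨r v, ?_⟩
    have := h v
    rwa [hv, hs, add_zero] at this
  · rintro ⟨u, rfl⟩
    have := h (i u)
    rw [hri, add_eq_left] at this
    rw [← hps (p (i u)), this, map_zero]

namespace BTensor

section Functoriality

variable {k : Type} [Field k]
  {A B C : Type} [Ring A] [Ring B] [Ring C] [Algebra k A] [Algebra k B] [Algebra k C]
  {X X' X'' : Type} [AddCommGroup X] [Module k X] [Module (A ⊗[k] Bᵐᵒᵖ) X]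
  [IsScalarTower k (A ⊗[k] Bᵐᵒᵖ) X]
  [AddCommGroup X'] [Module k X'] [Module (A ⊗[k] Bᵐᵒᵖ) X']
  [IsScalarTower k (A ⊗[k] Bᵐᵒᵖ) X']
  [AddCommGroup X''] [Module k X''] [Module (A ⊗[k] Bᵐᵒᵖ) X'']
  [IsScalarTower k (A ⊗[k] Bᵐᵒᵖ) X'']
  {Y Y' Y'' : Type} [AddCommGroup Y] [Module k Y] [Module (B ⊗[k] Cᵐᵒᵖ) Y]
  [IsScalarTower k (B ⊗[k] Cᵐᵒᵖ) Y]
  [AddCommGroup Y'] [Module k Y'] [Module (B ⊗[k] Cᵐᵒᵖ) Y']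
  [IsScalarTower k (B ⊗[k] Cᵐᵒᵖ) Y']
  [AddCommGroup Y''] [Module k Y''] [Module (B ⊗[k] Cᵐᵒᵖ) Y'']
  [IsScalarTower k (B ⊗[k] Cᵐᵒᵖ) Y'']

theorem exists_map (u : X →ₗ[k] X') (v : Y →ₗ[k] Y')
    (hu : ∀ (b : Bᵐᵒᵖ) (x : X), u (((1 : A) ⊗ₜ[k] b) • x) = ((1 : A) ⊗ₜ[k] b) • u x)
    (hv : ∀ (b : B) (y : Y), v ((b ⊗ₜ[k] (1 : Cᵐᵒᵖ)) • y) = (b ⊗ₜ[k] (1 : Cᵐᵒᵖ)) • v y) :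
    ∃ f : BTensor k A B C X Y →ₗ[k] BTensor k A B C X' Y',
      ∀ x y, f (tmul k A B C x y) = tmul k A B C (u x) (v y) :=
  exists_lift ((TensorProduct.mk k X' Y').compr₂ (mkHom k A B C X' Y') |>.compl₁₂ u v)
    fun x b y => by
      change tmul k A B C _ _ = tmul k A B C _ _
      rw [hu, hv, balanced]

theorem exists_linear_map (u : X →ₗ[A ⊗[k] Bᵐᵒᵖ] X') (v : Y →ₗ[B ⊗[k] Cᵐᵒᵖ] Y') :
    ∃ f : BTensor k A B C X Y →ₗ[A ⊗[k] Cᵐᵒᵖ] BTensor k A B C X' Y',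
      ∀ x y, f (tmul k A B C x y) = tmul k A B C (u x) (v y) :=
  exists_linear_lift ((TensorProduct.mk k X' Y').compr₂ (mkHom k A B C X' Y') |>.compl₁₂
      (u.restrictScalars k) (v.restrictScalars k))
    (fun x b y => by
      change tmul k A B C (u _) (v _) = tmul k A B C (u _) (v _)
      rw [map_smul, map_smul, balanced])
    (fun a c x y => by
      change tmul k A B C (u _) (v _) = (a ⊗ₜ[k] c) • tmul k A B C (u _) (v _)
      rw [map_smul, map_smul, smul_tmul])

variable (Y) in
/-- A short exact sequence that splits on the right stays exact after tensoring on the right. -/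
theorem exists_exact_left (i : X →ₗ[A ⊗[k] Bᵐᵒᵖ] X') (p : X' →ₗ[A ⊗[k] Bᵐᵒᵖ] X'')
    (r : X' →ₗ[k] X) (s : X'' →ₗ[k] X')
    (hr : ∀ (b : Bᵐᵒᵖ) (x : X'), r (((1 : A) ⊗ₜ[k] b) • x) = ((1 : A) ⊗ₜ[k] b) • r x)
    (hs : ∀ (b : Bᵐᵒᵖ) (x : X''), s (((1 : A) ⊗ₜ[k] b) • x) = ((1 : A) ⊗ₜ[k] b) • s x)
    (hri : ∀ x, r (i x) = x) (hps : ∀ x, p (s x) = x) (h : ∀ x, i (r x) + s (p x) = x) :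
    ∃ (i' : BTensor k A B C X Y →ₗ[A ⊗[k] Cᵐᵒᵖ] BTensor k A B C X' Y)
      (p' : BTensor k A B C X' Y →ₗ[A ⊗[k] Cᵐᵒᵖ] BTensor k A B C X'' Y),
      Function.Injective i' ∧ Function.Surjective p' ∧ Function.Exact i' p' := by
  obtain ⟨i', hi'⟩ := exists_linear_map i (LinearMap.id : Y →ₗ[B ⊗[k] Cᵐᵒᵖ] Y)
  obtain ⟨p', hp'⟩ := exists_linear_map p (LinearMap.id : Y →ₗ[B ⊗[k] Cᵐᵒᵖ] Y)
  obtain ⟨r', hr'⟩ := exists_map (C := C) r (LinearMap.id : Y →ₗ[k] Y) hr (fun _ _ => rfl)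
  obtain ⟨s', hs'⟩ := exists_map (C := C) s (LinearMap.id : Y →ₗ[k] Y) hs (fun _ _ => rfl)
  refine ⟨i', p', exact_of_split i' p' r' s' (fun z => ?_) (fun z => ?_) (map_zero s')
    fun z => ?_⟩
  · induction z using induction_on with
    | zero => simp only [map_zero]
    | tmul x y => simp only [hi', hr', hri, LinearMap.id_apply]
    | add z w hz hw => simp only [map_add, hz, hw]
  · induction z using induction_on with
    | zero => simp only [map_zero]
    | tmul x y => simp only [hs', hp', hps, LinearMap.id_apply]
    | add z w hz hw => simp only [map_add, hz, hw]
  · induction z using induction_on with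
    | zero => simp only [map_zero, add_zero]
    | tmul x y => simp only [hi', hr', hs', hp', LinearMap.id_apply, ← add_tmul, h]
    | add z w hz hw =>
      conv_rhs => rw [← hz, ← hw]
      simp only [map_add]
      abel

variable (X) in
/-- A short exact sequence that splits on the left stays exact after tensoring on the left. -/
theorem exists_exact_right (i : Y →ₗ[B ⊗[k] Cᵐᵒᵖ] Y') (p : Y' →ₗ[B ⊗[k] Cᵐᵒᵖ] Y'')
    (r : Y' →ₗ[k] Y) (s : Y'' →ₗ[k] Y')
    (hr : ∀ (b : B) (y : Y'), r ((b ⊗ₜ[k] (1 : Cᵐᵒᵖ)) • y) = (b ⊗ₜ[k] (1 : Cᵐᵒᵖ)) • r y)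
    (hs : ∀ (b : B) (y : Y''), s ((b ⊗ₜ[k] (1 : Cᵐᵒᵖ)) • y) = (b ⊗ₜ[k] (1 : Cᵐᵒᵖ)) • s y)
    (hri : ∀ y, r (i y) = y) (hps : ∀ y, p (s y) = y) (h : ∀ y, i (r y) + s (p y) = y) :
    ∃ (i' : BTensor k A B C X Y →ₗ[A ⊗[k] Cᵐᵒᵖ] BTensor k A B C X Y')
      (p' : BTensor k A B C X Y' →ₗ[A ⊗[k] Cᵐᵒᵖ] BTensor k A B C X Y''),
      Function.Injective i' ∧ Function.Surjective p' ∧ Function.Exact i' p' := by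
  obtain ⟨i', hi'⟩ := exists_linear_map (LinearMap.id : X →ₗ[A ⊗[k] Bᵐᵒᵖ] X) i
  obtain ⟨p', hp'⟩ := exists_linear_map (LinearMap.id : X →ₗ[A ⊗[k] Bᵐᵒᵖ] X) p
  obtain ⟨r', hr'⟩ := exists_map (A := A) (LinearMap.id : X →ₗ[k] X) r (fun _ _ => rfl) hr
  obtain ⟨s', hs'⟩ := exists_map (A := A) (LinearMap.id : X →ₗ[k] X) s (fun _ _ => rfl) hs
  refine ⟨i', p', exact_of_split i' p' r' s' (fun z => ?_) (fun z => ?_) (map_zero s')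
    fun z => ?_⟩
  · induction z using induction_on with
    | zero => simp only [map_zero]
    | tmul x y => simp only [hi', hr', hri, LinearMap.id_apply]
    | add z w hz hw => simp only [map_add, hz, hw]
  · induction z using induction_on with
    | zero => simp only [map_zero]
    | tmul x y => simp only [hs', hp', hps, LinearMap.id_apply]
    | add z w hz hw => simp only [map_add, hz, hw]
  · induction z using induction_on with
    | zero => simp only [map_zero, add_zero]
    | tmul x y => simp only [hi', hr', hs', hp', LinearMap.id_apply, ← tmul_add, h]
    | add z w hz hw =>
      conv_rhs => rw [← hz, ← hw]
      simp only [map_add]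
      abel

end Functoriality

section Projective

variable {k : Type} [Field k]
  {A B C : Type} [Ring A] [Ring B] [Ring C] [Algebra k A] [Algebra k B] [Algebra k C]

/-- Tensoring a free bimodule with a bimodule that is projective on the right yields a projective
bimodule. -/
theorem exists_section_of_projective_right (n : ℕ) {Y : Type} [AddCommGroup Y] [Module k Y]
    [Module (B ⊗[k] Cᵐᵒᵖ) Y] [IsScalarTower k (B ⊗[k] Cᵐᵒᵖ) Y]
    (hY : letI := rightRestrict k B C Y; Module.Projective Cᵐᵒᵖ Y)
    {D : Type} [AddCommGroup D] [Module k D] [Module (A ⊗[k] Cᵐᵒᵖ) D]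
    [IsScalarTower k (A ⊗[k] Cᵐᵒᵖ) D]
    (f : D →ₗ[A ⊗[k] Cᵐᵒᵖ] BTensor k A B C (Fin n → A ⊗[k] Bᵐᵒᵖ) Y)
    (hf : Function.Surjective f) :
    ∃ g : BTensor k A B C (Fin n → A ⊗[k] Bᵐᵒᵖ) Y →ₗ[A ⊗[k] Cᵐᵒᵖ] D, f ∘ₗ g = LinearMap.id := by
  classical
  let e (i : Fin n) : Fin n → A ⊗[k] Bᵐᵒᵖ := Pi.single i 1
  choose h hh hfh using fun i => _root_.exists_lift (S := A ⊗[k] Cᵐᵒᵖ)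
    (F := D) (P := BTensor k A B C _ _)
    (Algebra.TensorProduct.includeRight : Cᵐᵒᵖ →ₐ[k] B ⊗[k] Cᵐᵒᵖ)
    (Algebra.TensorProduct.includeRight : Cᵐᵒᵖ →ₐ[k] A ⊗[k] Cᵐᵒᵖ) hY f hf
    ((TensorProduct.mk k _ Y).compr₂ (mkHom k A B C _ Y) (e i)) (fun c y => by
      change tmul k A B C (e i) (((1 : B) ⊗ₜ[k] c) • y) =
        ((1 : A) ⊗ₜ[k] c) • tmul k A B C (e i) y
      rw [smul_tmul, ← Algebra.TensorProduct.one_def, one_smul])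
  change ∀ i (c : Cᵐᵒᵖ) y, h i (((1 : B) ⊗ₜ[k] c) • y) = ((1 : A) ⊗ₜ[k] c) • h i y at hh
  change ∀ i y, f (h i y) = tmul k A B C (e i) y at hfh
  let G (i : Fin n) : A ⊗[k] Bᵐᵒᵖ →ₗ[k] Y →ₗ[k] D :=
    TensorProduct.lift (LinearMap.mk₂ k
      (fun a b => Algebra.lsmul k k _ (a ⊗ₜ[k] (1 : Cᵐᵒᵖ)) ∘ₗ h i ∘ₗ
        Algebra.lsmul k k Y (b.unop ⊗ₜ[k] (1 : Cᵐᵒᵖ)))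
      (fun a a' b => by ext1 y; simp [TensorProduct.add_tmul])
      (fun c a b => by ext1 y; simp [← TensorProduct.smul_tmul'])
      (fun a b b' => by ext1 y; simp [TensorProduct.add_tmul])
      (fun c a b => by
        ext1 y
        simp [← TensorProduct.smul_tmul', smul_algebra_smul_comm]))
  have hG (i : Fin n) (a : A) (b : Bᵐᵒᵖ) (y : Y) : G i (a ⊗ₜ b) y =
      (a ⊗ₜ[k] (1 : Cᵐᵒᵖ)) • h i ((b.unop ⊗ₜ[k] (1 : Cᵐᵒᵖ)) • y) := rfl
  let F : (Fin n → A ⊗[k] Bᵐᵒᵖ) →ₗ[k] Y →ₗ[k]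
      D :=
    ∑ i, G i ∘ₗ LinearMap.proj i
  have hbal (x : Fin n → A ⊗[k] Bᵐᵒᵖ) (b : B) (y : Y) :
      F (((1 : A) ⊗ₜ[k] op b) • x) y = F x ((b ⊗ₜ[k] (1 : Cᵐᵒᵖ)) • y) := by
    simp only [F, LinearMap.sum_apply, LinearMap.comp_apply, LinearMap.proj_apply, Pi.smul_apply]
    refine Finset.sum_congr rfl fun i _ => ?_
    induction x i using TensorProduct.induction_on with
    | zero => simp
    | add s t hs ht =>
      rw [smul_add, map_add, map_add, LinearMap.add_apply, LinearMap.add_apply, hs, ht]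
    | tmul a c => simp [hG, ← mul_smul]
  have hout (a : A) (c : Cᵐᵒᵖ) (x : Fin n → A ⊗[k] Bᵐᵒᵖ) (y : Y) :
      F ((a ⊗ₜ[k] (1 : Bᵐᵒᵖ)) • x) (((1 : B) ⊗ₜ[k] c) • y) = (a ⊗ₜ[k] c) • F x y := by
    simp only [F, LinearMap.sum_apply, LinearMap.comp_apply, LinearMap.proj_apply, Pi.smul_apply,
      Finset.smul_sum]
    refine Finset.sum_congr rfl fun i _ => ?_
    induction x i using TensorProduct.induction_on with
    | zero => simp
    | add s t hs ht =>
      rw [smul_add, map_add, map_add, LinearMap.add_apply, LinearMap.add_apply, hs, ht, smul_add]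
    | tmul a' b =>
      have h1 := outer_comm (k := k) (X := Y) b.unop c.unop y
      rw [op_unop] at h1
      rw [smul_eq_mul, Algebra.TensorProduct.tmul_mul_tmul, one_mul, hG, hG, h1, hh, ← mul_smul,
        ← mul_smul]
      simp
  obtain ⟨g, hg⟩ := exists_linear_lift F hbal hout
  refine ⟨g, LinearMap.ext fun z => ?_⟩
  rw [LinearMap.comp_apply, LinearMap.id_apply]
  induction z using induction_on with
  | zero => rw [map_zero, map_zero]
  | add z w hz hw => rw [map_add, map_add, hz, hw]
  | tmul x y =>
    have key (i : Fin n) (t : A ⊗[k] Bᵐᵒᵖ) : f (G i t y) = tmul k A B C (Pi.single i t) y := by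
      induction t using TensorProduct.induction_on with
      | zero => simp [tmul]
      | add s t hs ht => simp [Pi.single_add, add_tmul, hs, ht]
      | tmul a b =>
        rw [hG, map_smul, hfh, smul_tmul, ← Algebra.TensorProduct.one_def, one_smul, ← balanced,
          ← mul_smul]
        congr 1
        ext j
        by_cases hij : j = i
        · subst hij; simp [e]
        · simp [e, hij]
    have hx : tmul k A B C x y = ∑ i, tmul k A B C (Pi.single i (x i)) y := by
      conv_lhs => rw [← Finset.univ_sum_single x, tmul, TensorProduct.sum_tmul, map_sum]
      rfl
    rw [hg, hx]
    simp [F, key]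

theorem projective_of_right (n : ℕ) {Y : Type} [AddCommGroup Y] [Module k Y]
    [Module (B ⊗[k] Cᵐᵒᵖ) Y] [IsScalarTower k (B ⊗[k] Cᵐᵒᵖ) Y]
    (hY : letI := rightRestrict k B C Y; Module.Projective Cᵐᵒᵖ Y) :
    Module.Projective (A ⊗[k] Cᵐᵒᵖ) (BTensor k A B C (Fin n → A ⊗[k] Bᵐᵒᵖ) Y) :=
  .of_lifting_property'' fun f hf =>
    exists_section_of_projective_right (A := A) (D := _ →₀ A ⊗[k] Cᵐᵒᵖ) n hY f hf

/-- Tensoring a bimodule that is projective on the left with a free bimodule yields a projective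
bimodule. -/
theorem exists_section_of_projective_left (n : ℕ) {X : Type} [AddCommGroup X] [Module k X]
    [Module (A ⊗[k] Bᵐᵒᵖ) X] [IsScalarTower k (A ⊗[k] Bᵐᵒᵖ) X]
    (hX : letI := leftRestrict k A B X; Module.Projective A X)
    {D : Type} [AddCommGroup D] [Module k D] [Module (A ⊗[k] Cᵐᵒᵖ) D]
    [IsScalarTower k (A ⊗[k] Cᵐᵒᵖ) D]
    (f : D →ₗ[A ⊗[k] Cᵐᵒᵖ] BTensor k A B C X (Fin n → B ⊗[k] Cᵐᵒᵖ))
    (hf : Function.Surjective f) :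
    ∃ g : BTensor k A B C X (Fin n → B ⊗[k] Cᵐᵒᵖ) →ₗ[A ⊗[k] Cᵐᵒᵖ] D, f ∘ₗ g = LinearMap.id := by
  classical
  let e (i : Fin n) : Fin n → B ⊗[k] Cᵐᵒᵖ := Pi.single i 1
  choose h hh hfh using fun i => _root_.exists_lift (S := A ⊗[k] Cᵐᵒᵖ)
    (F := D) (P := BTensor k A B C _ _)
    (Algebra.TensorProduct.includeLeft : A →ₐ[k] A ⊗[k] Bᵐᵒᵖ)
    (Algebra.TensorProduct.includeLeft : A →ₐ[k] A ⊗[k] Cᵐᵒᵖ) hX f hf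
    (((TensorProduct.mk k X _).compr₂ (mkHom k A B C X _)).flip (e i)) (fun a x => by
      change tmul k A B C ((a ⊗ₜ[k] (1 : Bᵐᵒᵖ)) • x) (e i) =
        (a ⊗ₜ[k] (1 : Cᵐᵒᵖ)) • tmul k A B C x (e i)
      rw [smul_tmul, ← Algebra.TensorProduct.one_def, one_smul])
  change ∀ i (a : A) x, h i ((a ⊗ₜ[k] (1 : Bᵐᵒᵖ)) • x) = (a ⊗ₜ[k] (1 : Cᵐᵒᵖ)) • h i x at hh
  change ∀ i x, f (h i x) = tmul k A B C x (e i) at hfh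
  let G (i : Fin n) : B ⊗[k] Cᵐᵒᵖ →ₗ[k] X →ₗ[k] D :=
    TensorProduct.lift (LinearMap.mk₂ k
      (fun b c => Algebra.lsmul k k _ ((1 : A) ⊗ₜ[k] c) ∘ₗ h i ∘ₗ
        Algebra.lsmul k k X ((1 : A) ⊗ₜ[k] op b))
      (fun b b' c => by ext1 y; simp [TensorProduct.tmul_add])
      (fun t b c => by
        ext1 y
        simp [TensorProduct.tmul_smul, smul_algebra_smul_comm])
      (fun b c c' => by ext1 y; simp [TensorProduct.tmul_add])
      (fun t b c => by ext1 y; simp [TensorProduct.tmul_smul]))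
  have hG (i : Fin n) (b : B) (c : Cᵐᵒᵖ) (x : X) : G i (b ⊗ₜ c) x =
      ((1 : A) ⊗ₜ[k] c) • h i (((1 : A) ⊗ₜ[k] op b) • x) := rfl
  let F : X →ₗ[k] (Fin n → B ⊗[k] Cᵐᵒᵖ) →ₗ[k]
      D :=
    (∑ i, G i ∘ₗ LinearMap.proj i).flip
  have hbal (x : X) (b : B) (y : Fin n → B ⊗[k] Cᵐᵒᵖ) :
      F (((1 : A) ⊗ₜ[k] op b) • x) y = F x ((b ⊗ₜ[k] (1 : Cᵐᵒᵖ)) • y) := by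
    simp only [F, LinearMap.flip_apply, LinearMap.sum_apply, LinearMap.comp_apply,
      LinearMap.proj_apply, Pi.smul_apply]
    refine Finset.sum_congr rfl fun i _ => ?_
    induction y i using TensorProduct.induction_on with
    | zero => simp
    | add s t hs ht =>
      rw [smul_add, map_add, map_add, LinearMap.add_apply, LinearMap.add_apply, hs, ht]
    | tmul b' c => simp [hG, ← mul_smul]
  have hout (a : A) (c : Cᵐᵒᵖ) (x : X) (y : Fin n → B ⊗[k] Cᵐᵒᵖ) :
      F ((a ⊗ₜ[k] (1 : Bᵐᵒᵖ)) • x) (((1 : B) ⊗ₜ[k] c) • y) = (a ⊗ₜ[k] c) • F x y := by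
    simp only [F, LinearMap.flip_apply, LinearMap.sum_apply, LinearMap.comp_apply,
      LinearMap.proj_apply, Pi.smul_apply, Finset.smul_sum]
    refine Finset.sum_congr rfl fun i _ => ?_
    induction y i using TensorProduct.induction_on with
    | zero => simp
    | add s t hs ht =>
      rw [smul_add, map_add, map_add, LinearMap.add_apply, LinearMap.add_apply, hs, ht, smul_add]
    | tmul b c' =>
      rw [smul_eq_mul, Algebra.TensorProduct.tmul_mul_tmul, one_mul, hG, hG, ← outer_comm, hh,
        ← mul_smul (_ : A ⊗[k] Cᵐᵒᵖ), ← mul_smul (_ : A ⊗[k] Cᵐᵒᵖ)]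
      simp
  obtain ⟨g, hg⟩ := exists_linear_lift F hbal hout
  refine ⟨g, LinearMap.ext fun z => ?_⟩
  rw [LinearMap.comp_apply, LinearMap.id_apply]
  induction z using induction_on with
  | zero => rw [map_zero, map_zero]
  | add z w hz hw => rw [map_add, map_add, hz, hw]
  | tmul x y =>
    have key (i : Fin n) (t : B ⊗[k] Cᵐᵒᵖ) : f (G i t x) = tmul k A B C x (Pi.single i t) := by
      induction t using TensorProduct.induction_on with
      | zero => simp [tmul]
      | add s t hs ht => simp [Pi.single_add, tmul_add, hs, ht]
      | tmul b c =>
        rw [hG, map_smul, hfh, smul_tmul, ← Algebra.TensorProduct.one_def, one_smul, balanced,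
          ← mul_smul]
        congr 1
        ext j
        by_cases hij : j = i
        · subst hij; simp [e]
        · simp [e, hij]
    have hy : tmul k A B C x y = ∑ i, tmul k A B C x (Pi.single i (y i)) := by
      conv_lhs => rw [← Finset.univ_sum_single y, tmul, TensorProduct.tmul_sum, map_sum]
      rfl
    rw [hg, hy]
    simp [F, key]

theorem projective_of_left (n : ℕ) {X : Type} [AddCommGroup X] [Module k X]
    [Module (A ⊗[k] Bᵐᵒᵖ) X] [IsScalarTower k (A ⊗[k] Bᵐᵒᵖ) X]
    (hX : letI := leftRestrict k A B X; Module.Projective A X) :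
    Module.Projective (A ⊗[k] Cᵐᵒᵖ) (BTensor k A B C X (Fin n → B ⊗[k] Cᵐᵒᵖ)) :=
  .of_lifting_property'' fun f hf =>
    exists_section_of_projective_left (C := C) (D := _ →₀ A ⊗[k] Cᵐᵒᵖ) n hX f hf

end Projective

end BTensor

section Level

variable {k Λ Γ : Type} [Field k] [Ring Λ] [Ring Γ] [Algebra k Λ] [Algebra k Γ]
  [FiniteDimensional k Λ] [FiniteDimensional k Γ]

/-- For self-injective algebras, replacing `M` by a cosyzygy lowers the level by one. -/
theorem DefinesSingEqOfLevel.exists_of_succ (hΛ : Module.Injective Λ Λ) (hΓ : Module.Injective Γ Γ)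
    {M : Type} [AddCommGroup M] [Module k M] [Module (Λ ⊗[k] Γᵐᵒᵖ) M]
    [IsScalarTower k (Λ ⊗[k] Γᵐᵒᵖ) M]
    {N : Type} [AddCommGroup N] [Module k N] [Module (Γ ⊗[k] Λᵐᵒᵖ) N]
    [IsScalarTower k (Γ ⊗[k] Λᵐᵒᵖ) N] {l : ℕ} (h : DefinesSingEqOfLevel k Λ Γ M N (l + 1)) :
    ∃ w : SingEqMoritaLevel k Λ Γ, w.l = l := by
  obtain ⟨hMl, hMr, hNl, hNr, ⟨Z, ⟨W, hW, hZ⟩, hMN⟩, ⟨Z', ⟨W', hW', hZ'⟩, hNM⟩⟩ := h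
  have qΛ : IsQF k Λ := .of_injective hΛ
  have qΓ : IsQF k Γ := .of_injective hΓ
  let ιl : Λ →ₐ[k] Λ ⊗[k] Γᵐᵒᵖ := Algebra.TensorProduct.includeLeft
  let ιr : Γᵐᵒᵖ →ₐ[k] Λ ⊗[k] Γᵐᵒᵖ := Algebra.TensorProduct.includeRight
  have fM : FiniteDimensional k M := finiteDimensional_of_compHom ιl M hMl.1
  have fN : FiniteDimensional k N := finiteDimensional_of_compHom
    (Algebra.TensorProduct.includeLeft : Γ →ₐ[k] Γ ⊗[k] Λᵐᵒᵖ) N hNl.1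
  have : Module.Finite (Λ ⊗[k] Γᵐᵒᵖ) M := Module.Finite.of_restrictScalars_finite k _ M
  obtain ⟨n, i, hi⟩ := (qΛ.tensorProduct qΓ.mulOpposite).exists_injective_pi M
  let p := (LinearMap.range i).mkQ
  have hp : Function.Surjective p := Submodule.mkQ_surjective _
  have hip : Function.Exact i p := LinearMap.exact_map_mkQ_range i
  obtain ⟨r₁, hr₁, hri₁⟩ := exists_retraction ιl hΛ hMl i hi
  obtain ⟨r₂, hr₂, hri₂⟩ := exists_retraction ιr qΓ.mulOpposite.injective_self hMr i hi
  obtain ⟨s₁, hs₁, hps₁, h₁⟩ := exists_section ιl i p hip hp r₁ hr₁ hri₁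
  obtain ⟨s₂, hs₂, hps₂, h₂⟩ := exists_section ιr i p hip hp r₂ hr₂ hri₂
  obtain ⟨i', p', hi', hp', hip'⟩ :=
    BTensor.exists_exact_left (C := Λ) N i p r₂ s₂ hr₂ hs₂ hri₂ hps₂ h₂
  obtain ⟨i'', p'', hi'', hp'', hip''⟩ :=
    BTensor.exists_exact_right (A := Γ) N i p r₁ s₁ hr₁ hs₁ hri₁ hps₁ h₁
  have := BTensor.projective_of_right (A := Λ) n hNr.2
  have := BTensor.projective_of_left (C := Γ) n hNl.2
  have : FiniteDimensional k (BTensor k Λ Γ Λ (Fin n → Λ ⊗[k] Γᵐᵒᵖ) N) := BTensor.finiteDimensional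
  have : FiniteDimensional k (BTensor k Γ Λ Γ N (Fin n → Λ ⊗[k] Γᵐᵒᵖ)) := BTensor.finiteDimensional
  have : Module.Finite (Λ ⊗[k] Λᵐᵒᵖ) (BTensor k Λ Γ Λ (Fin n → Λ ⊗[k] Γᵐᵒᵖ) N) :=
    Module.Finite.of_restrictScalars_finite k _ _
  have : Module.Finite (Γ ⊗[k] Γᵐᵒᵖ) (BTensor k Γ Λ Γ N (Fin n → Λ ⊗[k] Γᵐᵒᵖ)) :=
    Module.Finite.of_restrictScalars_finite k _ _
  have fM' : FiniteDimensional k ((Fin n → Λ ⊗[k] Γᵐᵒᵖ) ⧸ LinearMap.range i) :=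
    Module.Finite.of_surjective (p.restrictScalars k) hp
  refine ⟨⟨(Fin n → Λ ⊗[k] Γᵐᵒᵖ) ⧸ LinearMap.range i, N, l, ⟨?_, ?_, hNl, hNr, ?_, ?_⟩⟩, rfl⟩
  · exact ⟨finite_compHom ιl _, projective_compHom_of_retract ιl
      (projective_compHom_pi ιl (projective_leftRestrict_tensorProduct k Λ Γ) n) p s₁ hs₁ hps₁⟩
  · exact ⟨finite_compHom ιr _, projective_compHom_of_retract ιr
      (projective_compHom_pi ιr (projective_rightRestrict_tensorProduct k Λ Γ) n) p s₂ hs₂ hps₂⟩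
  · exact ⟨W, hW, .of_isSyzygyOf (qΛ.tensorProduct qΛ.mulOpposite).injective_self
      i' p' hi' hp' hip' hZ hMN⟩
  · exact ⟨W', hW', .of_isSyzygyOf (qΓ.tensorProduct qΓ.mulOpposite).injective_self
      i'' p'' hi'' hp'' hip'' hZ' hNM⟩

theorem SingEqMoritaLevel.exists_level_zero (hΛ : Module.Injective Λ Λ)
    (hΓ : Module.Injective Γ Γ) (l : ℕ) (w : SingEqMoritaLevel k Λ Γ) (hw : w.l = l) :
    ∃ w' : SingEqMoritaLevel k Λ Γ, w'.l = 0 := by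
  induction l generalizing w with
  | zero => exact ⟨w, hw⟩
  | succ l ih =>
    obtain ⟨M, N, m, h⟩ := w
    subst hw
    obtain ⟨w', hw'⟩ := h.exists_of_succ hΛ hΓ
    exact ih w' hw'

end Level

/-- for finite dimensional self-injective algebras, singular equivalence of
Morita type with some level is the same as with level `0` (stable equivalence of Morita
type). -/
theorem statement_9 (k Λ Γ : Type) [Field k] [Ring Λ] [Ring Γ]
    [Algebra k Λ] [Algebra k Γ] [FiniteDimensional k Λ] [FiniteDimensional k Γ]
    (hΛ : Module.Injective Λ Λ) (hΓ : Module.Injective Γ Γ) :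
    Nonempty (SingEqMoritaLevel k Λ Γ) ↔
      ∃ w : SingEqMoritaLevel k Λ Γ, w.l = 0 :=
  ⟨fun ⟨w⟩ => w.exists_level_zero hΛ hΓ w.l rfl, fun ⟨w, _⟩ => ⟨w⟩⟩
end
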